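/- Let G be a locally finite acyclic Borel graph on a standard Borel space X such that no connected component of G has exactly 0 ends or exactly 2 ends, and let μ be a Borel probability measure on X. Then there is a μ-conull Borel set B ⊆ X and a one-ended Borel function f : B → X whose graph is contained in G. -/

import Mathlib

open MeasureTheory

/-- A partial function `f : B → X` is *one-ended* if there is no infinite sequence
`x₀, x₁, x₂, …` of points of `B` with `f (x_{i+1}) = x_i` for all `i`. -/
def OneEnded {X : Type*} {B : Set X} (f : B → X) : Prop :=
  ¬ ∃ u : ℕ → B, ∀ i : ℕ, f (u (i + 1)) = (u i : X)

/-- A set of vertices is `G`-invariant if it is a union of connected components of `G`. -/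
def GraphInvariant {X : Type*} (G : SimpleGraph X) (A : Set X) : Prop :=
  ∀ ⦃x y : X⦄, G.Reachable x y → x ∈ A → y ∈ A

/-- `[A]_{E_G}`: the union of all connected components of `G` meeting `A`. -/
def EGSat {X : Type*} (G : SimpleGraph X) (A : Set X) : Set X :=
  {x | ∃ a ∈ A, G.Reachable x a}

/-- `S` is biconnected: the induced subgraph on `S` is connected and remains connected
(in the sense of `Preconnected`) after deleting any single vertex of `S`. -/
def BiconnectedSet {X : Type*} (G : SimpleGraph X) (S : Set X) : Prop :=
  (G.induce S).Connected ∧ ∀ x ∈ S, (G.induce (S \ {x})).Preconnected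

/-- A block of `G` is a maximal biconnected set. -/
def GraphBlock {X : Type*} (G : SimpleGraph X) (S : Set X) : Prop :=
  BiconnectedSet G S ∧ ∀ T : Set X, BiconnectedSet G T → S ⊆ T → T = S

/-- The induced subgraph on `S` is a cycle of odd length. -/
def OddCycleSet {X : Type*} (G : SimpleGraph X) (S : Set X) : Prop :=
  ∃ n : ℕ, Odd n ∧ 3 ≤ n ∧ Nonempty (G.induce S ≃g SimpleGraph.cycleGraph n)

/-- A Gallai tree is a connected graph each of whose blocks induces a complete
graph or an odd cycle. -/
def GallaiTree {X : Type*} (G : SimpleGraph X) : Prop :=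
  G.Connected ∧ ∀ S : Set X, GraphBlock G S → G.IsClique S ∨ OddCycleSet G S

/-- A graph is ample if every vertex has degree at least 2 and for every vertex `x`,
every connected component of the restriction of `G` to the complement of `{x}`
contains a vertex of degree at least 3 in that restriction. -/
def AmpleGraph {X : Type*} (G : SimpleGraph X) : Prop :=
  (∀ x : X, 2 ≤ (G.neighborSet x).encard) ∧
  ∀ x : X, ∀ y : ({x}ᶜ : Set X), ∃ z : ({x}ᶜ : Set X),
    (G.induce ({x}ᶜ : Set X)).Reachable y z ∧
      3 ≤ ((G.induce ({x}ᶜ : Set X)).neighborSet z).encard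

/-- `x E^even_G y`: `x` and `y` are joined by a path of even length in `G`. -/
def EvenRel {X : Type*} (G : SimpleGraph X) (x y : X) : Prop :=
  ∃ p : G.Walk x y, p.IsPath ∧ Even p.length

/-- A set is `E^even_G`-invariant if it is a union of `E^even_G`-classes. -/
def EvenInvariant {X : Type*} (G : SimpleGraph X) (C : Set X) : Prop :=
  ∀ ⦃x y : X⦄, EvenRel G x y → x ∈ C → y ∈ C

namespace OneEndedProof

/-! ### Novikov's separation theorem -/

/-- A sequence of sets is contained in a sequence of Borel sets with empty intersection. -/
def SeqSeparable {α : Type*} [MeasurableSpace α] (S : ℕ → Set α) : Prop :=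
  ∃ B : ℕ → Set α, (∀ n, MeasurableSet (B n)) ∧ (∀ n, S n ⊆ B n) ∧ ∀ a, ∃ n, a ∉ B n

theorem SeqSeparable.split {α : Type*} [MeasurableSpace α] {S : ℕ → Set α} (m : ℕ)
    (T : ℕ → Set α) (hS : S m ⊆ ⋃ k, T k)
    (h : ∀ k, SeqSeparable (Function.update S m (T k))) : SeqSeparable S := by
  choose B hB hsub hemp using h
  refine ⟨Function.update (fun n => ⋂ k, B k n) m (⋃ k, B k m), ?_, ?_, ?_⟩
  · intro n
    by_cases hn : n = m
    · subst hn; simpa using MeasurableSet.iUnion fun k => hB k n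
    · simpa [hn] using MeasurableSet.iInter fun k => hB k n
  · intro n
    by_cases hn : n = m
    · subst hn
      simp only [Function.update_self]
      refine hS.trans (Set.iUnion_mono fun k => ?_)
      simpa using hsub k n
    · simp only [Function.update_of_ne hn]
      refine Set.subset_iInter fun k => ?_
      simpa [hn] using hsub k n
  · intro a
    by_cases ha : ∃ k, a ∈ B k m
    · obtain ⟨k, hk⟩ := ha
      obtain ⟨n, hn⟩ := hemp k a
      have hnm : n ≠ m := by rintro rfl; exact hn hk
      exact ⟨n, by simpa [hnm] using ⟨k, hn⟩⟩
    · exact ⟨m, by simpa using ha⟩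

theorem seqSeparable_range {α : Type*} [TopologicalSpace α] [T2Space α] [MeasurableSpace α]
    [OpensMeasurableSpace α] (f : ℕ → (ℕ → ℕ) → α) (hf : ∀ n, Continuous (f n))
    (hemp : ∀ a, ∃ n, a ∉ Set.range (f n)) : SeqSeparable fun n => Set.range (f n) := by
  classical
  by_contra hns
  let D : (ℕ → ℕ) → ℕ → ℕ → Set (ℕ → ℕ) := fun z t n => {x | ∀ i, Nat.pair n i < t → x i = z (Nat.pair n i)}
  have hstep : ∀ z t, ¬ SeqSeparable (fun n => f n '' D z t n) →
      ∃ k, ¬ SeqSeparable (fun n => f n '' D (Function.update z t k) (t + 1) n) := by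
    intro z t
    contrapose!
    intro h
    refine SeqSeparable.split (Nat.unpair t).1
      (fun k => f (Nat.unpair t).1 '' D (Function.update z t k) (t + 1) (Nat.unpair t).1) ?_ ?_
    · rintro _ ⟨x, hx, rfl⟩
      refine Set.mem_iUnion.2 ⟨x (Nat.unpair t).2, x, ?_, rfl⟩
      intro i hi
      rcases Nat.lt_succ_iff_lt_or_eq.1 hi with hi | hi
      · rw [Function.update_of_ne hi.ne]; exact hx i hi
      · have : i = (Nat.unpair t).2 := by rw [← hi]; simp
        rw [hi, Function.update_self, this]
    · intro k
      convert! h k using 1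
      funext n
      by_cases hn : n = (Nat.unpair t).1
      · subst hn; simp
      · rw [Function.update_of_ne hn]
        have : D (Function.update z t k) (t + 1) n = D z t n := by
          ext x
          refine forall_congr' fun i => ?_
          have hne : Nat.pair n i ≠ t := by rintro rfl; simp at hn
          rw [Function.update_of_ne hne]
          exact ⟨fun h hi => h (by omega), fun h hi => h (by omega)⟩
        rw [this]
  choose! k hk using hstep
  let Z : ℕ → ℕ → ℕ := fun t => Nat.rec (fun _ => 0) (fun t z => Function.update z t (k z t)) t
  have hZ : ∀ t, ¬ SeqSeparable (fun n => f n '' D (Z t) t n) := by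
    intro t
    induction t with
    | zero => simpa [D, Set.image_univ] using hns
    | succ t ih => exact hk _ _ ih
  let z : ℕ → ℕ := fun t => Z (t + 1) t
  have hag : ∀ t i, i < t → Z t i = z i := by
    intro t
    induction t with
    | zero => intro i hi; omega
    | succ t ih =>
      intro i hi
      rcases Nat.lt_succ_iff_lt_or_eq.1 hi with hi | rfl
      · rw [← ih i hi]
        exact Function.update_of_ne hi.ne _ _
      · rfl
  have hz : ∀ t, ¬ SeqSeparable (fun n => f n '' D z t n) := by
    intro t
    convert! hZ t using 4 with n
    ext x
    refine forall_congr' fun i => forall_congr' fun hi => ?_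
    rw [hag t _ hi]
  let x : ℕ → ℕ → ℕ := fun n i => z (Nat.pair n i)
  have hne : ∃ a b, f a (x a) ≠ f b (x b) := by
    by_contra! h
    obtain ⟨n, hn⟩ := hemp (f 0 (x 0))
    exact hn ⟨x n, h n 0⟩
  obtain ⟨a, b, hab⟩ := hne
  obtain ⟨u, v, hu, hv, hau, hbv, huv⟩ := t2_separation hab
  have hsmall : ∀ (n : ℕ) (w : Set α), IsOpen w → f n (x n) ∈ w →
      ∃ t, ∀ s, t ≤ s → f n '' D z s n ⊆ w := by
    intro n w hw hxw
    have hop := hw.preimage (hf n)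
    obtain ⟨I, U, hU, hsub⟩ := isOpen_pi_iff.1 hop _ hxw
    refine ⟨I.sup (fun i => Nat.pair n i) + 1, fun s hs => ?_⟩
    rintro _ ⟨y, hy, rfl⟩
    refine hsub (fun i hi => ?_)
    have : y i = x n i := hy i (by have := Finset.le_sup (f := fun i => Nat.pair n i) hi; omega)
    rw [this]; exact (hU i hi).2
  obtain ⟨s, hs⟩ := hsmall a u hu hau
  obtain ⟨t, ht⟩ := hsmall b v hv hbv
  have hab' : a ≠ b := by rintro rfl; exact hab rfl
  refine hz (max s t) ⟨Function.update (Function.update (fun _ => Set.univ) a u) b v, ?_, ?_, ?_⟩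
  · intro n
    by_cases hn : n = b
    · subst hn; simpa using hv.measurableSet
    · by_cases hn' : n = a
      · subst hn'; simpa [hn] using hu.measurableSet
      · simp [hn, hn']
  · intro n
    by_cases hn : n = b
    · subst hn; simpa using Set.image_subset_iff.1 (ht _ (le_max_right _ _))
    · by_cases hn' : n = a
      · subst hn'; simpa [hn] using Set.image_subset_iff.1 (hs _ (le_max_left _ _))
      · simp [hn, hn']
  · intro p
    by_cases hp : p ∈ u
    · exact ⟨b, by simpa using Set.disjoint_left.1 huv hp⟩
    · exact ⟨a, by simpa [hab'] using hp⟩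

/-- **Novikov's separation theorem**: a sequence of analytic sets with empty intersection is
contained in a sequence of Borel sets with empty intersection. -/
theorem seqSeparable_of_analyticSet {α : Type*} [TopologicalSpace α] [T2Space α]
    [MeasurableSpace α] [OpensMeasurableSpace α] (A : ℕ → Set α) (hA : ∀ n, AnalyticSet (A n))
    (hemp : ∀ a, ∃ n, a ∉ A n) : SeqSeparable A := by
  classical
  by_cases h : ∃ m, A m = ∅
  · obtain ⟨m, hm⟩ := h
    refine ⟨Function.update (fun _ => Set.univ) m ∅, fun n => ?_, fun n => ?_, fun a => ⟨m, by simp⟩⟩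
    · by_cases hn : n = m
      · subst hn; simp
      · simp [hn]
    · by_cases hn : n = m
      · subst hn; simp [hm]
      · simp [hn]
  · push Not at h
    have : ∀ n, ∃ f : (ℕ → ℕ) → α, Continuous f ∧ Set.range f = A n := by
      intro n
      have := hA n
      rw [AnalyticSet] at this
      exact this.resolve_left (h n).ne_empty
    choose f hf hr using this
    obtain rfl : (fun n => Set.range (f n)) = A := funext hr
    exact seqSeparable_range f hf hemp

/-! ### Countable isolating families and enumerations of locally finite Borel graphs -/

theorem exists_isolating_family (X : Type*) [MeasurableSpace X] [StandardBorelSpace X] :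
    ∃ U : ℕ → Set X, (∀ k, MeasurableSet (U k)) ∧
      ∀ (F : Set X) (x : X), F.Finite → ∃ k, x ∈ U k ∧ ∀ y ∈ F, y ≠ x → y ∉ U k := by
  let _ := upgradeStandardBorel X
  obtain ⟨b, hbc, hbne, hb⟩ := TopologicalSpace.exists_countable_basis X
  rcases isEmpty_or_nonempty X with hX | ⟨⟨x₀⟩⟩
  · exact ⟨fun _ => ∅, fun _ => MeasurableSet.empty, fun F x => (hX.false x).elim⟩
  have hne : b.Nonempty := by
    obtain ⟨s, hs, -⟩ := hb.exists_subset_of_mem_open (Set.mem_univ x₀) isOpen_univ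
    exact ⟨s, hs⟩
  obtain ⟨U, rfl⟩ := hbc.exists_eq_range hne
  refine ⟨U, fun k => (hb.isOpen ⟨k, rfl⟩).measurableSet, fun F x hF => ?_⟩
  have hop : IsOpen (F \ {x})ᶜ := (hF.subset Set.sdiff_subset).isClosed.isOpen_compl
  obtain ⟨_, ⟨k, rfl⟩, hxk, hsub⟩ := hb.exists_subset_of_mem_open (a := x) (by simp) hop
  exact ⟨k, hxk, fun y hy hyx hyk => hsub hyk ⟨hy, hyx⟩⟩

/-- A Borel relation with finite sections is covered by countably many Borel functions. -/
theorem exists_enumeration {X : Type*} [MeasurableSpace X] [StandardBorelSpace X]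
    (B : Set (X × X)) (hB : MeasurableSet B) (hfin : ∀ x, {y | (x, y) ∈ B}.Finite) :
    ∃ g : ℕ → X → X, (∀ n, Measurable (g n)) ∧ (∀ n x, g n x = x ∨ (x, g n x) ∈ B) ∧
      ∀ x y, (x, y) ∈ B → ∃ n, g n x = y := by
  classical
  obtain ⟨U, hU, hiso⟩ := exists_isolating_family X
  let _ := upgradeStandardBorel X
  let K : ℕ → Set (X × X) := fun k =>
    {p | p.2 ∈ U k ∧ ∀ y, (p.1, y) ∈ B → y ∈ U k → y = p.2}
  have hA : ∀ k, AnalyticSet (B \ K k) := by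
    intro k
    let E : Set ((X × X) × X) :=
      {q | q.1 ∈ B ∧ (q.1.2 ∉ U k ∨ ((q.1.1, q.2) ∈ B ∧ q.2 ∈ U k ∧ q.2 ≠ q.1.2))}
    have hE : MeasurableSet E := by
      have h1 : Measurable fun q : (X × X) × X => (q.1.1, q.2) := by fun_prop
      refine (measurable_fst hB).inter (MeasurableSet.union ?_ ((h1 hB).inter
        ((measurable_snd (hU k)).inter ?_)))
      · exact (measurable_snd.comp measurable_fst (hU k)).compl
      · exact (measurableSet_eq_fun measurable_snd (measurable_snd.comp measurable_fst)).compl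
    have : B \ K k = Prod.fst '' E := by
      ext p
      constructor
      · rintro ⟨hp, hpk⟩
        by_cases h2 : p.2 ∈ U k
        · have : ¬ ∀ y, (p.1, y) ∈ B → y ∈ U k → y = p.2 := fun h => hpk ⟨h2, h⟩
          push Not at this
          obtain ⟨y, hy, hyU, hne⟩ := this
          exact ⟨(p, y), ⟨hp, Or.inr ⟨hy, hyU, hne⟩⟩, rfl⟩
        · exact ⟨(p, p.1), ⟨hp, Or.inl h2⟩, rfl⟩
      · rintro ⟨q, ⟨hq, h⟩, rfl⟩
        refine ⟨hq, fun hk => ?_⟩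
        rcases h with h | ⟨h1, h2, h3⟩
        · exact h hk.1
        · exact h3 (hk.2 _ h1 h2)
    rw [this]
    exact hE.analyticSet_image measurable_fst
  obtain ⟨C, hC, hsub, hemp⟩ := seqSeparable_of_analyticSet (fun k => B \ K k) hA (by
    intro p
    obtain ⟨k, hk, hk'⟩ := hiso _ p.2 (hfin p.1)
    refine ⟨k, fun h => h.2 ⟨hk, fun y hy hyU => ?_⟩⟩
    by_contra hne
    exact hk' y hy hne hyU)
  let D : ℕ → Set (X × X) := fun k => B \ C k
  have hD : ∀ k, MeasurableSet (D k) := fun k => hB.diff (hC k)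
  have hDK : ∀ k p, p ∈ D k → p ∈ K k := by
    intro k p hp
    by_contra h
    exact hp.2 (hsub k ⟨hp.1, h⟩)
  have hfun : ∀ k x y y', (x, y) ∈ D k → (x, y') ∈ D k → y = y' := fun k x y y' h h' =>
    (hDK k _ h').2 y h.1 (hDK k _ h).1
  have hinj : ∀ k, Set.InjOn Prod.fst (D k) := by
    rintro k ⟨x, y⟩ h ⟨x', y'⟩ h' heq
    obtain rfl : x = x' := heq
    rw [hfun k _ _ _ h h']
  let g : ℕ → X → X := fun k x => if h : ∃ y, (x, y) ∈ D k then h.choose else x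
  have hg : ∀ k x y, (x, y) ∈ D k → g k x = y := by
    intro k x y hy
    have h : ∃ y, (x, y) ∈ D k := ⟨y, hy⟩
    simp only [g, dif_pos h]
    exact hfun k _ _ _ h.choose_spec hy
  have hg' : ∀ k x, (¬ ∃ y, (x, y) ∈ D k) → g k x = x := fun k x h => by simp only [g, dif_neg h]
  refine ⟨g, fun k => ?_, fun k x => ?_, fun x y hxy => ?_⟩
  · intro S hS
    have : g k ⁻¹' S = Prod.fst '' (D k ∩ Prod.snd ⁻¹' S) ∪ ((Prod.fst '' D k)ᶜ ∩ S) := by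
      ext x
      by_cases h : ∃ y, (x, y) ∈ D k
      · obtain ⟨y, hy⟩ := h
        simp only [Set.mem_preimage, hg k x y hy]
        constructor
        · intro hyS; exact Or.inl ⟨(x, y), ⟨hy, hyS⟩, rfl⟩
        · rintro (⟨⟨x', y'⟩, ⟨h1, h2⟩, rfl⟩ | ⟨h1, -⟩)
          · rw [hfun k _ _ _ hy h1]; exact h2
          · exact (h1 ⟨_, hy, rfl⟩).elim
      · simp only [Set.mem_preimage, hg' k x h]
        constructor
        · intro hx; exact Or.inr ⟨by rintro ⟨⟨x', y⟩, hy, rfl⟩; exact h ⟨y, hy⟩, hx⟩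
        · rintro (⟨⟨x', y'⟩, ⟨h1, h2⟩, rfl⟩ | ⟨-, h2⟩)
          · exact (h ⟨y', h1⟩).elim
          · exact h2
    rw [this]
    exact (((hD k).inter (measurable_snd hS)).image_of_measurable_injOn measurable_fst
      ((hinj k).mono Set.inter_subset_left)).union
      (((hD k).image_of_measurable_injOn measurable_fst (hinj k)).compl.inter hS)
  · by_cases h : ∃ y, (x, y) ∈ D k
    · obtain ⟨y, hy⟩ := h
      right; rw [hg k x y hy]; exact hy.1
    · exact Or.inl (hg' k x h)
  · obtain ⟨k, hk⟩ := hemp (x, y)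
    exact ⟨k, hg k x y ⟨hxy, hk⟩⟩

/-! ### Measurability of quantifiers bounded by a component -/

section Toolkit

set_option linter.unusedSectionVars false

variable {X : Type*} [MeasurableSpace X]

/-- The adjacency relation of `H` is Borel. -/
def BorelGraph (H : SimpleGraph X) : Prop := Measurable fun p : X × X => H.Adj p.1 p.2

theorem BorelGraph.adj {H : SimpleGraph X} (hH : BorelGraph H) {α : Type*} [MeasurableSpace α]
    {a b : α → X} (ha : Measurable a) (hb : Measurable b) : Measurable fun z => H.Adj (a z) (b z) :=
  Measurable.comp (g := fun p : X × X => H.Adj p.1 p.2) hH (ha.prodMk hb)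

theorem measurable_rel {P : X → X → Prop} (hP : Measurable fun p : X × X => P p.1 p.2)
    {α : Type*} [MeasurableSpace α] {a b : α → X} (ha : Measurable a) (hb : Measurable b) :
    Measurable fun z => P (a z) (b z) :=
  Measurable.comp (g := fun p : X × X => P p.1 p.2) hP (ha.prodMk hb)

theorem measurable_mem {S : Set X} (hS : MeasurableSet S) {α : Type*} [MeasurableSpace α]
    {a : α → X} (ha : Measurable a) : Measurable fun z => a z ∈ S :=
  measurableSet_setOfPred.1 (ha hS)

/-- A locally finite Borel graph. -/
structure BorelLF (G : SimpleGraph X) : Prop where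
  borel : BorelGraph G
  finite : ∀ x, (G.neighborSet x).Finite

theorem exists_measurable_least {α : Type*} [MeasurableSpace α] {P : α → ℕ → Prop}
    (hP : ∀ n, Measurable fun a => P a n) :
    ∃ φ : α → ℕ, Measurable φ ∧ ∀ a, (∃ n, P a n) → P a (φ a) ∧ ∀ m, P a m → φ a ≤ m := by
  classical
  have hex : ∀ a, ∃ n, P a n ∨ ¬ ∃ n, P a n := fun a => by
    by_cases h : ∃ n, P a n
    · obtain ⟨n, hn⟩ := h; exact ⟨n, Or.inl hn⟩
    · exact ⟨0, Or.inr h⟩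
  refine ⟨fun a => Nat.find (hex a), measurable_find hex fun n => ?_, fun a ha => ⟨?_, ?_⟩⟩
  · exact measurableSet_setOfPred.2 ((hP n).or (Measurable.exists hP).not)
  · exact (Nat.find_spec (hex a)).resolve_right (not_not.2 ha)
  · exact fun m hm => Nat.find_min' _ (Or.inl hm)

omit [MeasurableSpace X] in
theorem exists_forall_of_antitone {F : Set X} (hF : F.Finite) {P : ℕ → X → Prop}
    (hP : ∀ n x, P (n + 1) x → P n x) (h : ∀ n, ∃ x ∈ F, P n x) : ∃ x ∈ F, ∀ n, P n x := by
  by_contra! hne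
  choose! k hk using hne
  have hanti : ∀ x m n, m ≤ n → P n x → P m x := by
    intro x m n hmn
    induction hmn with
    | refl => exact id
    | step _ ih => exact fun h => ih (hP _ _ h)
  obtain ⟨x, hx, hxP⟩ := h (hF.toFinset.sup k)
  exact hk x hx (hanti x _ _ (Finset.le_sup (f := k) (hF.mem_toFinset.2 hx)) hxP)

variable [StandardBorelSpace X] {G : SimpleGraph X}

theorem BorelLF.exists_steps (hG : BorelLF G) :
    ∃ g : ℕ → X → X, (∀ n, Measurable (g n)) ∧ (∀ n x, g n x = x ∨ G.Adj x (g n x)) ∧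
      ∀ x y, G.Adj x y → ∃ n, g n x = y :=
  exists_enumeration {p : X × X | G.Adj p.1 p.2} (measurableSet_setOfPred.2 hG.borel) hG.finite

theorem BorelLF.exists_moves (hG : BorelLF G) :
    ∃ h : ℕ → X → X, (∀ n, Measurable (h n)) ∧ ∀ x y, G.Reachable x y → ∃ n, h n x = y := by
  obtain ⟨g, hg, -, hcov⟩ := hG.exists_steps
  let w : List ℕ → X → X := fun s => s.foldr (fun n φ => g n ∘ φ) id
  have hw : ∀ s, Measurable (w s) := by
    intro s
    induction s with
    | nil => exact measurable_id
    | cons n s ih => exact (hg n).comp ih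
  refine ⟨fun n => (Encodable.decode (α := List ℕ) n).elim id w, fun n => ?_, ?_⟩
  · rcases h : Encodable.decode (α := List ℕ) n with _ | s
    · simp only [h, Option.elim_none]; exact measurable_id
    · simp only [h, Option.elim_some]; exact hw s
  · rintro x y ⟨p⟩
    suffices ∃ s, w s x = y by
      obtain ⟨s, hs⟩ := this
      exact ⟨Encodable.encode s, by simpa using hs⟩
    have key : ∀ {u v : X} (p : G.Walk u v), ∃ s, w s v = u := by
      intro u v p
      induction p with
      | nil => exact ⟨[], rfl⟩
      | cons hadj p ih =>
        obtain ⟨s, hs⟩ := ih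
        obtain ⟨n, hn⟩ := hcov _ _ hadj.symm
        exact ⟨n :: s, by change g n (w s _) = _; rw [hs, hn]⟩
    exact key p.reverse

theorem BorelLF.measurable_exists (hG : BorelLF G) {α : Type*} [MeasurableSpace α] {b : α → X}
    (hb : Measurable b) {P : α → X → Prop} (hP : Measurable fun q : α × X => P q.1 q.2)
    (hr : ∀ a y, P a y → G.Reachable (b a) y) : Measurable fun a => ∃ y, P a y := by
  obtain ⟨h, hh, hcov⟩ := hG.exists_moves
  have : (fun a => ∃ y, P a y) = fun a => ∃ n, P a (h n (b a)) := by
    funext a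
    refine propext ⟨fun ⟨y, hy⟩ => ?_, fun ⟨n, hn⟩ => ⟨_, hn⟩⟩
    obtain ⟨n, rfl⟩ := hcov _ _ (hr a y hy)
    exact ⟨n, hy⟩
  rw [this]
  exact Measurable.exists fun n =>
    Measurable.comp (g := fun q : α × X => P q.1 q.2) hP (measurable_id.prodMk ((hh n).comp hb))

theorem BorelLF.measurable_forall (hG : BorelLF G) {α : Type*} [MeasurableSpace α] {b : α → X}
    (hb : Measurable b) {P : α → X → Prop} (hP : Measurable fun q : α × X => P q.1 q.2)
    (hr : ∀ a y, ¬ P a y → G.Reachable (b a) y) : Measurable fun a => ∀ y, P a y := by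
  have := (hG.measurable_exists hb (P := fun a y => ¬ P a y) hP.not hr).not
  simpa using this

theorem BorelLF.exists_selector (hG : BorelLF G) {α : Type*} [MeasurableSpace α] {b : α → X}
    (hb : Measurable b) {P : α → X → Prop} (hP : Measurable fun q : α × X => P q.1 q.2)
    (hr : ∀ a y, P a y → G.Reachable (b a) y) :
    ∃ φ : α → X, Measurable φ ∧ ∀ a, (∃ y, P a y) → P a (φ a) := by
  obtain ⟨h, hh, hcov⟩ := hG.exists_moves
  obtain ⟨k, hk, hk'⟩ := exists_measurable_least (P := fun a n => P a (h n (b a))) fun n =>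
    Measurable.comp (g := fun q : α × X => P q.1 q.2) hP (measurable_id.prodMk ((hh n).comp hb))
  refine ⟨fun a => h (k a) (b a), ?_, fun a ⟨y, hy⟩ => ?_⟩
  · have : Measurable fun p : ℕ × X => h p.1 p.2 := measurable_from_prod_countable_right hh
    exact this.comp (hk.prodMk hb)
  · obtain ⟨n, rfl⟩ := hcov _ _ (hr a y hy)
    exact (hk' a ⟨n, hy⟩).1

/-- A Borel graph on the components of `G` with finite out-degrees has a countable Borel
colouring. -/
theorem BorelLF.exists_coloring (hG : BorelLF G) {R : X → X → Prop}
    (hR : Measurable fun p : X × X => R p.1 p.2) (hreach : ∀ x y, R x y → G.Reachable x y)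
    (hfin : ∀ x, {y | R x y}.Finite) (hirr : ∀ x, ¬ R x x) :
    ∃ col : X → ℕ, Measurable col ∧ ∀ x y, R x y → col x ≠ col y := by
  obtain ⟨U, hU, hiso⟩ := exists_isolating_family X
  obtain ⟨col, hcol, hcol'⟩ := exists_measurable_least
    (P := fun x k => x ∈ U k ∧ ∀ y, R x y → y ∉ U k) fun k =>
      (measurable_mem (hU k) measurable_id).and
        (hG.measurable_forall measurable_id
          (hR.imp (measurable_mem (hU k) measurable_snd).not)
          (fun x y h => by push Not at h; exact hreach _ _ h.1))
  have hex : ∀ x, ∃ k, x ∈ U k ∧ ∀ y, R x y → y ∉ U k := by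
    intro x
    obtain ⟨k, hk, hk'⟩ := hiso _ x (hfin x)
    exact ⟨k, hk, fun y hy => hk' y hy (by rintro rfl; exact hirr _ hy)⟩
  refine ⟨col, hcol, fun x y hxy heq => ?_⟩
  refine (hcol' x (hex x)).1.2 y hxy ?_
  rw [heq]
  exact (hcol' y (hex y)).1.1

/-! ### One-ended maps defined on parts of the space -/

/-- The vertices incident to an edge of `H`. -/
def supp (H : SimpleGraph X) : Set X := {x | ∃ y, H.Adj x y}

theorem BorelLF.measurableSet_supp (hG : BorelLF G) {H : SimpleGraph X} (hH : BorelGraph H)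
    (hle : H ≤ G) : MeasurableSet (supp H) :=
  measurableSet_setOfPred.2 <| hG.measurable_exists measurable_id hH fun _ _ h => (hle h).reachable

theorem BorelLF.measurable_reachable (hG : BorelLF G) {H : SimpleGraph X} (hH : BorelGraph H)
    (hle : H ≤ G) : Measurable fun p : X × X => H.Reachable p.1 p.2 := by
  let W : ℕ → X → X → Prop := fun n => Nat.rec (fun x y => x = y)
    (fun _ P x y => ∃ z, H.Adj x z ∧ P z y) n
  have hW : ∀ n, Measurable fun p : X × X => W n p.1 p.2 := by
    intro n
    induction n with
    | zero =>
      let _ := upgradeStandardBorel X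
      exact measurableSet_setOfPred.1 (measurableSet_eq_fun measurable_fst measurable_snd)
    | succ n ih =>
      refine hG.measurable_exists measurable_fst (P := fun p z => H.Adj p.1 z ∧ W n z p.2) ?_
        fun a y h => (hle h.1).reachable
      exact (hH.adj (measurable_fst.comp measurable_fst) measurable_snd).and
        (measurable_rel ih measurable_snd (measurable_snd.comp measurable_fst))
  have : (fun p : X × X => H.Reachable p.1 p.2) = fun p => ∃ n, W n p.1 p.2 := by
    funext ⟨x, y⟩
    refine propext ⟨?_, ?_⟩
    · intro h
      obtain ⟨p⟩ : H.Reachable x y := h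
      change ∃ n, W n x y
      induction p with
      | nil => exact ⟨0, rfl⟩
      | cons hadj p ih => obtain ⟨n, hn⟩ := ih; exact ⟨n + 1, _, hadj, hn⟩
    · rintro ⟨n, hn⟩
      change W n x y at hn
      change H.Reachable x y
      induction n generalizing x with
      | zero => obtain rfl : x = y := hn; exact SimpleGraph.Reachable.refl _
      | succ n ih => obtain ⟨z, hz, hn⟩ := hn; exact hz.reachable.trans (ih _ hn)
  rw [this]
  exact Measurable.exists hW

/-- There is a Borel function on the space which moves every point of `B` along an edge of `G` and
which is one-ended on `B`. -/
def Flow (G : SimpleGraph X) (B : Set X) : Prop :=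
  ∃ f : X → X, Measurable f ∧ (∀ x ∈ B, G.Adj x (f x)) ∧
    ¬ ∃ u : ℕ → X, (∀ i, u i ∈ B) ∧ ∀ i, f (u (i + 1)) = u i

theorem Flow.union {B₁ B₂ : Set X} (h₁ : Flow G B₁) (h₂ : Flow G B₂) (hm : MeasurableSet B₁)
    (hinv : ∀ x y, G.Adj x y → x ∈ B₁ → y ∈ B₁) : Flow G (B₁ ∪ B₂) := by
  classical
  obtain ⟨f, hf, hadj, hone⟩ := h₁
  obtain ⟨f', hf', hadj', hone'⟩ := h₂
  refine ⟨fun x => if x ∈ B₁ then f x else f' x, Measurable.ite hm hf hf', ?_, ?_⟩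
  · intro x hx
    by_cases h : x ∈ B₁
    · simpa [h] using hadj x h
    · simpa [h] using hadj' x (hx.resolve_left h)
  · rintro ⟨u, hu, hu'⟩
    by_cases h0 : u 0 ∈ B₁
    · have hall : ∀ i, u i ∈ B₁ := by
        intro i
        induction i with
        | zero => exact h0
        | succ i ih =>
          by_contra h
          have h1 := hu' i
          simp only [h, if_false] at h1
          have h2 := hadj' _ ((hu (i + 1)).resolve_left h)
          rw [h1] at h2
          exact h (hinv _ _ h2.symm ih)
      exact hone ⟨u, hall, fun i => by simpa [hall] using hu' i⟩
    · have hall : ∀ i, u i ∉ B₁ := by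
        intro i
        induction i with
        | zero => exact h0
        | succ i ih =>
          intro h
          have h1 := hu' i
          simp only [h, if_true] at h1
          have h2 := hadj _ h
          rw [h1] at h2
          exact ih (hinv _ _ h2 h)
      exact hone' ⟨u, fun i => (hu i).resolve_left (hall i), fun i => by simpa [hall] using hu' i⟩

theorem exists_rank (hG : BorelLF G) {K : SimpleGraph X} (hK : BorelGraph K) (hle : K ≤ G)
    {A : Set X} (hA : MeasurableSet A) :
    ∃ rk : X → ℕ, Measurable rk ∧ ∀ x, x ∉ A → (∃ a ∈ A, K.Reachable x a) →
      ∃ y, K.Adj x y ∧ rk y < rk x := by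
  let P : ℕ → X → Prop := fun n => Nat.rec (fun x => x ∈ A)
    (fun _ P x => P x ∨ ∃ y, K.Adj x y ∧ P y) n
  have hP : ∀ n, Measurable (P n) := by
    intro n
    induction n with
    | zero => exact measurable_mem hA measurable_id
    | succ n ih =>
      exact ih.or (hG.measurable_exists measurable_id (P := fun x y => K.Adj x y ∧ P n y)
        (Measurable.and hK (ih.comp measurable_snd)) fun a y h => (hle h.1).reachable)
  obtain ⟨rk, hrk, hrk'⟩ := exists_measurable_least (P := fun x n => P n x) hP
  refine ⟨rk, hrk, ?_⟩
  rintro x hx ⟨a, ha, ⟨p⟩⟩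
  have hex : ∃ n, P n x := by
    clear hx
    induction p with
    | nil => exact ⟨0, ha⟩
    | cons hadj p ih => obtain ⟨n, hn⟩ := ih ha; exact ⟨n + 1, Or.inr ⟨_, hadj, hn⟩⟩
  obtain ⟨h1, h2⟩ := hrk' x hex
  cases hn : rk x with
  | zero => rw [hn] at h1; exact (hx h1).elim
  | succ n =>
    rw [hn] at h1
    rcases h1 with h1 | ⟨y, hy, h1⟩
    · have := h2 n h1; omega
    · exact ⟨y, hy, Nat.lt_succ_of_le ((hrk' y ⟨n, h1⟩).2 n h1)⟩

/-- The flow towards a complete section `A` of `K`, corrected to be one-ended. -/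
theorem exists_flow_toward (hG : BorelLF G) {K : SimpleGraph X} (hK : BorelGraph K) (hle : K ≤ G)
    {A : Set X} (hA : MeasurableSet A) {S : Set X}
    (hS : S = {x | x ∉ A ∧ ∃ a ∈ A, K.Reachable x a}) :
    ∃ f : X → X, Measurable f ∧ (∀ x ∈ S, K.Adj x (f x)) ∧
      ¬ ∃ u : ℕ → X, (∀ i, u i ∈ S) ∧ ∀ i, f (u (i + 1)) = u i := by
  classical
  let _ := upgradeStandardBorel X
  have hSm : MeasurableSet S := by
    rw [hS]
    exact measurableSet_setOfPred.2 <| (measurable_mem hA measurable_id).not.and <|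
      hG.measurable_exists measurable_id (P := fun x a => a ∈ A ∧ K.Reachable x a)
        ((measurable_mem hA measurable_snd).and (hG.measurable_reachable hK hle))
        fun a y h => h.2.mono hle
  obtain ⟨rk, hrk, hrk'⟩ := exists_rank hG hK hle hA
  obtain ⟨f, hf, hf'⟩ := hG.exists_selector measurable_id
    (P := fun x y => K.Adj x y ∧ rk y < rk x)
    (Measurable.and hK (measurableSet_setOfPred.1
      (measurableSet_lt (hrk.comp measurable_snd) (hrk.comp measurable_fst))))
    fun a y h => (hle h.1).reachable
  have hfS : ∀ x ∈ S, K.Adj x (f x) ∧ rk (f x) < rk x := fun x hx => by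
    rw [hS] at hx
    exact hf' x (hrk' x hx.1 hx.2)
  let P : ℕ → X → Prop := fun n => Nat.rec (fun x => x ∈ S)
    (fun _ P x => x ∈ S ∧ ∃ y, (y ∈ S ∧ f y = x) ∧ P y) n
  have hfm : Measurable fun p : X × X => p.2 ∈ S ∧ f p.2 = p.1 :=
    (measurable_mem hSm measurable_snd).and (measurableSet_setOfPred.1
      (measurableSet_eq_fun (hf.comp measurable_snd) measurable_fst))
  have hreach : ∀ x y, (y ∈ S ∧ f y = x) → G.Adj x y := by
    rintro x y ⟨h1, rfl⟩
    exact (hle (hfS y h1).1).symm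
  have hP : ∀ n, Measurable (P n) := by
    intro n
    induction n with
    | zero => exact measurable_mem hSm measurable_id
    | succ n ih =>
      exact (measurable_mem hSm measurable_id).and (hG.measurable_exists measurable_id
        (P := fun x y => (y ∈ S ∧ f y = x) ∧ P n y) (hfm.and (ih.comp measurable_snd))
        fun a y h => (hreach _ _ h.1).reachable)
  have hPS : ∀ n x, P n x → x ∈ S := by
    intro n x h
    cases n with
    | zero => exact h
    | succ n => exact h.1
  have hanti : ∀ n x, P (n + 1) x → P n x := by
    intro n
    induction n with
    | zero => exact fun x h => h.1
    | succ n ih => exact fun x ⟨h1, y, h2, h3⟩ => ⟨h1, y, h2, ih y h3⟩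
  let C : Set X := {x | ∀ n, P n x}
  have hC : MeasurableSet C := measurableSet_setOfPred.2 (Measurable.forall hP)
  have hback : ∀ x ∈ C, ∃ y, (y ∈ S ∧ f y = x) ∧ y ∈ C := by
    intro x hx
    obtain ⟨y, hy, hy'⟩ := exists_forall_of_antitone (F := {y | y ∈ S ∧ f y = x})
      ((hG.finite x).subset fun y hy => hreach _ _ hy) hanti
      (fun n => by obtain ⟨-, y, h1, h2⟩ := hx (n + 1); exact ⟨y, h1, h2⟩)
    exact ⟨y, hy, hy'⟩
  obtain ⟨b, hb, hb'⟩ := hG.exists_selector measurable_id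
    (P := fun x y : X => (y ∈ S ∧ f y = x) ∧ y ∈ C) (hfm.and (measurable_mem hC measurable_snd))
    fun a y h => (hreach _ _ h.1).reachable
  have hCd : DecidablePred (· ∈ C) := Classical.decPred _
  refine ⟨fun x => if x ∈ C then b x else f x, Measurable.ite hC hb hf, ?_, ?_⟩
  · intro x hx
    by_cases hxC : x ∈ C
    · obtain ⟨⟨h1, h2⟩, -⟩ := hb' x (hback x hxC)
      have := (hfS _ h1).1.symm
      rw [h2] at this
      simpa [hxC] using this
    · simpa [hxC] using (hfS x hx).1
  · rintro ⟨u, hu, hu'⟩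
    have hstep : ∀ i, u (i + 1) ∈ C → u i ∈ C := by
      intro i hi
      have := hu' i
      simp only [hi, if_true] at this
      rw [← this]
      exact (hb' _ (hback _ hi)).2
    by_cases hall : ∀ i, u i ∈ C
    · have hdec : ∀ i, rk (u (i + 1)) < rk (u i) := by
        intro i
        have h1 := hu' i
        simp only [hall, if_true] at h1
        have h2 := (hb' _ (hback _ (hall (i + 1)))).1
        rw [h1] at h2
        rw [← h2.2]
        exact (hfS _ h2.1).2
      have hbd : ∀ i, rk (u i) + i ≤ rk (u 0) := by
        intro i
        induction i with
        | zero => simp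
        | succ i ih => have := hdec i; omega
      have := hbd (rk (u 0) + 1)
      omega
    · push Not at hall
      obtain ⟨i₀, hi₀⟩ := hall
      have hnot : ∀ j, u (i₀ + j) ∉ C := by
        intro j
        induction j with
        | zero => exact hi₀
        | succ j ih => exact fun h => ih (hstep _ h)
      have hchain : ∀ n j, P n (u (i₀ + j)) := by
        intro n
        induction n with
        | zero => exact fun j => hu _
        | succ n ih =>
          intro j
          refine ⟨hu _, u (i₀ + (j + 1)), ⟨hu _, ?_⟩, ih _⟩
          have := hu' (i₀ + j)
          simp only [← add_assoc] at this ⊢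
          have h2 := hnot (j + 1)
          rw [← add_assoc] at h2
          simpa [h2] using this
      exact hi₀ fun n => hchain n 0

theorem Flow.of_complete_section (hG : BorelLF G) {A : Set X} (hA : MeasurableSet A) {f : X → X}
    (hf : Measurable f) (hadj : ∀ x ∈ A, G.Adj x (f x)) (hmaps : ∀ x ∈ A, f x ∈ A)
    (hone : ¬ ∃ u : ℕ → X, (∀ i, u i ∈ A) ∧ ∀ i, f (u (i + 1)) = u i) :
    Flow G {x | ∃ a ∈ A, G.Reachable x a} := by
  classical
  obtain ⟨f', hf', hadj', hone'⟩ := exists_flow_toward hG hG.borel le_rfl hA rfl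
  refine ⟨fun x => if x ∈ A then f x else f' x, Measurable.ite hA hf hf', ?_, ?_⟩
  · intro x hx
    by_cases h : x ∈ A
    · simpa [h] using hadj x h
    · simpa [h] using hadj' x ⟨h, hx⟩
  · rintro ⟨u, hu, hu'⟩
    by_cases hall : ∀ i, u i ∈ A
    · exact hone ⟨u, hall, fun i => by simpa [hall] using hu' i⟩
    · push Not at hall
      obtain ⟨i₀, hi₀⟩ := hall
      have hnot : ∀ j, u (i₀ + j) ∉ A := by
        intro j
        induction j with
        | zero => exact hi₀
        | succ j ih =>
          intro h
          have h1 := hu' (i₀ + j)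
          rw [add_assoc] at h1
          simp only [h, if_true] at h1
          exact ih (h1 ▸ hmaps _ h)
      refine hone' ⟨fun j => u (i₀ + j), fun j => ⟨hnot j, hu _⟩, fun j => ?_⟩
      have h1 := hu' (i₀ + j)
      rw [add_assoc] at h1
      simpa only [hnot (j + 1), if_false] using h1

/-- Flows along a decreasing sequence of subgraphs. -/
theorem Flow.of_chain (hG : BorelLF G) {K : ℕ → SimpleGraph X} (hK : ∀ n, BorelGraph (K n))
    (hle : ∀ n, K n ≤ G) (hanti : ∀ n, K (n + 1) ≤ K n) {S : Set X} (hS0 : S ⊆ supp (K 0))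
    (hreach : ∀ n, ∀ x ∈ S, x ∈ supp (K n) → ∃ y ∈ supp (K (n + 1)), (K n).Reachable x y) :
    Flow G {x | x ∈ S ∧ ∃ n, x ∉ supp (K n)} := by
  have hsm : ∀ n, MeasurableSet (supp (K n)) := fun n => hG.measurableSet_supp (hK n) (hle n)
  choose f hf hadj hone using fun n => exists_flow_toward hG (hK n) (hle n) (hsm (n + 1)) rfl
  have hmono : ∀ m n, m ≤ n → supp (K n) ⊆ supp (K m) := by
    intro m n hmn
    induction hmn with
    | refl => exact le_rfl
    | step _ ih => exact fun x ⟨y, hy⟩ => ih ⟨y, hanti _ hy⟩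
  obtain ⟨st, hst, hst'⟩ := exists_measurable_least (P := fun x n => x ∉ supp (K (n + 1)))
    fun n => (measurable_mem (hsm (n + 1)) measurable_id).not
  have key : ∀ x, x ∈ S → (∃ n, x ∉ supp (K n)) →
      x ∈ supp (K (st x)) ∧ x ∉ supp (K (st x + 1)) := by
    rintro x hxS ⟨n, hn⟩
    obtain ⟨h1, h2⟩ := hst' x ⟨n, fun h => hn (hmono _ _ (Nat.le_succ n) h)⟩
    refine ⟨?_, h1⟩
    cases hs : st x with
    | zero => exact hS0 hxS
    | succ m =>
      by_contra h
      have := h2 m h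
      omega
  refine ⟨fun x => f (st x) x, ?_, ?_, ?_⟩
  · have : Measurable fun p : ℕ × X => f p.1 p.2 := measurable_from_prod_countable_right hf
    exact this.comp (hst.prodMk measurable_id)
  · rintro x ⟨hxS, hx⟩
    obtain ⟨h1, h2⟩ := key x hxS hx
    exact hle _ (hadj _ x ⟨h2, hreach _ x hxS h1⟩)
  · rintro ⟨u, hu, hu'⟩
    have hst_anti : ∀ i, st (u (i + 1)) ≤ st (u i) := by
      intro i
      obtain ⟨h1, h2⟩ := key _ (hu (i + 1)).1 (hu (i + 1)).2
      have h3 := hadj _ _ ⟨h2, hreach _ _ (hu (i + 1)).1 h1⟩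
      have h4 := hu' i
      simp only at h4
      rw [h4] at h3
      by_contra! hlt
      exact (key _ (hu i).1 (hu i).2).2 (hmono _ _ hlt ⟨_, h3.symm⟩)
    obtain ⟨N, hN⟩ : ∃ N, ∀ i, st (u N) ≤ st (u i) := by
      have hne : (Set.range fun i => st (u i)).Nonempty := Set.range_nonempty _
      obtain ⟨N, hN⟩ := Nat.sInf_mem hne
      refine ⟨N, fun i => ?_⟩
      simp only at hN
      rw [hN]
      exact Nat.sInf_le ⟨i, rfl⟩
    have hconst : ∀ j, st (u (N + j)) = st (u N) := by
      intro j
      refine le_antisymm ?_ (hN _)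
      induction j with
      | zero => exact le_rfl
      | succ j ih => exact (hst_anti (N + j)).trans ih
    refine hone (st (u N)) ⟨fun j => u (N + j), fun j => ?_, fun j => ?_⟩
    · obtain ⟨h1, h2⟩ := key _ (hu (N + j)).1 (hu (N + j)).2
      rw [hconst] at h1 h2
      exact ⟨h2, hreach _ _ (hu (N + j)).1 h1⟩
    · have := hu' (N + j)
      simp only at this
      rw [add_assoc, hconst] at this
      exact this

end Toolkit

/-! ### Walks in acyclic graphs -/

section Combinatorics

variable {X : Type*} {G H : SimpleGraph X}

/-- `y` and `z` are joined by a walk avoiding `x`. -/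
def Avoid (G : SimpleGraph X) (x y z : X) : Prop := ∃ p : G.Walk y z, x ∉ p.support

theorem Avoid.refl {x y : X} (h : x ≠ y) : Avoid G x y y := ⟨.nil, by simpa using h⟩

theorem Avoid.symm {x y z : X} (h : Avoid G x y z) : Avoid G x z y := by
  obtain ⟨p, hp⟩ := h
  exact ⟨p.reverse, by simpa using hp⟩

theorem Avoid.trans {x y z w : X} (h : Avoid G x y z) (h' : Avoid G x z w) : Avoid G x y w := by
  obtain ⟨p, hp⟩ := h
  obtain ⟨q, hq⟩ := h'
  refine ⟨p.append q, fun hx => ?_⟩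
  rcases (SimpleGraph.Walk.mem_support_append_iff p q).1 hx with hx | hx
  exacts [hp hx, hq hx]

theorem Avoid.of_adj {x y z : X} (h : G.Adj y z) (hy : x ≠ y) (hz : x ≠ z) : Avoid G x y z :=
  ⟨h.toWalk, by simp [hy, hz]⟩

theorem Avoid.of_chain {x : X} {u : ℕ → X} {n : ℕ} (hu : ∀ i < n, G.Adj (u i) (u (i + 1)))
    {a b : ℕ} (hab : a ≤ b) (hb : b ≤ n) (hx : ∀ i, a ≤ i → i ≤ b → x ≠ u i) :
    Avoid G x (u a) (u b) := by
  induction b, hab using Nat.le_induction with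
  | base => exact .refl (hx a le_rfl le_rfl)
  | succ b hab ih =>
    exact (ih (by omega) fun i hi hi' => hx i hi (by omega)).trans
      (.of_adj (hu b (by omega)) (hx b hab (by omega)) (hx _ (by omega) le_rfl))

theorem eq_of_avoid (hG : G.IsAcyclic) {x y z : X} (hy : G.Adj x y) (hz : G.Adj x z)
    (h : Avoid G x y z) : y = z := by
  classical
  obtain ⟨p, hp⟩ := h
  by_contra hne
  have hq : (SimpleGraph.Walk.cons hy.symm (SimpleGraph.Walk.cons hz .nil)).IsPath := by
    simp [SimpleGraph.Walk.cons_isPath_iff, hz.ne, hy.ne', hne]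
  have := (hG.subsingleton_path _ _).elim p.toPath ⟨_, hq⟩
  have hx : x ∈ (p.toPath : G.Walk y z).support := by rw [this]; simp
  exact hp (SimpleGraph.Walk.support_bypass_subset_support p hx)

/-- A non-backtracking chain in an acyclic graph is injective. -/
theorem chain_ne (hG : G.IsAcyclic) {u : ℕ → X} {n : ℕ} (hu : ∀ i < n, G.Adj (u i) (u (i + 1)))
    (hnb : ∀ i, i + 1 < n → u (i + 2) ≠ u i) : ∀ i j, i < j → j ≤ n → u i ≠ u j := by
  suffices ∀ d i j, j = i + d + 1 → j ≤ n → u i ≠ u j from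
    fun i j hij hj => this (j - i - 1) i j (by omega) hj
  intro d
  induction d using Nat.strong_induction_on with
  | _ d ih =>
    rintro i j rfl hj heq
    match d, ih, hj, heq with
    | 0, _, hj, heq => exact (hu i (by omega)).ne heq
    | 1, _, hj, heq => exact hnb i (by omega) heq.symm
    | d + 2, ih, hj, heq =>
      have h1 : G.Adj (u i) (u (i + 1)) := hu i (by omega)
      have h2 : G.Adj (u i) (u (i + 1 + (d + 1))) := by
        rw [heq, show i + (d + 2) + 1 = i + 1 + (d + 1) + 1 by omega]
        exact (hu _ (by omega)).symm
      refine ih d (by omega) (i + 1) (i + 1 + (d + 1)) (by omega) (by omega)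
        (eq_of_avoid hG h1 h2 ?_)
      refine Avoid.of_chain hu (by omega) (by omega) fun k hk hk' => ?_
      exact ih (k - i - 1) (by omega) i k (by omega) (by omega)

theorem seq_injective (hG : G.IsAcyclic) {u : ℕ → X} (hu : ∀ i, G.Adj (u i) (u (i + 1)))
    (hnb : ∀ i, u (i + 2) ≠ u i) : Function.Injective u := by
  intro i j hij
  by_contra hne
  rcases lt_or_gt_of_ne hne with h | h
  · exact chain_ne hG (n := j) (fun i _ => hu i) (fun i _ => hnb i) i j h le_rfl hij
  · exact chain_ne hG (n := i) (fun i _ => hu i) (fun i _ => hnb i) j i h le_rfl hij.symm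

/-! ### Infinite directions and the core -/

/-- There is a non-backtracking chain with `n + 1` edges starting with the edge `x y`. -/
def Far (G : SimpleGraph X) : ℕ → X → X → Prop
  | 0, x, y => G.Adj x y
  | n + 1, x, y => G.Adj x y ∧ ∃ z, z ≠ x ∧ G.Adj y z ∧ Far G n y z

theorem Far.adj {n : ℕ} {x y : X} (h : Far G n x y) : G.Adj x y := by
  cases n with
  | zero => exact h
  | succ n => exact h.1

theorem Far.pred : ∀ {n : ℕ} {x y : X}, Far G (n + 1) x y → Far G n x y
  | 0, _, _, h => h.1
  | _ + 1, _, _, ⟨h, z, hz, hyz, h'⟩ => ⟨h, z, hz, hyz, h'.pred⟩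

/-- There are arbitrarily long non-backtracking chains starting with the edge `x y`. -/
def Inf (G : SimpleGraph X) (x y : X) : Prop := ∀ n, Far G n x y

theorem Inf.adj {x y : X} (h : Inf G x y) : G.Adj x y := (h 0).adj

theorem Inf.cons {x y z : X} (h : Inf G y z) (hxy : G.Adj x y) (hne : z ≠ x) : Inf G x y
  | 0 => hxy
  | n + 1 => ⟨hxy, z, hne, h.adj, h n⟩

theorem Inf.next (hfin : ∀ x, (G.neighborSet x).Finite) {x y : X} (h : Inf G x y) :
    ∃ z, z ≠ x ∧ Inf G y z := by
  obtain ⟨z, ⟨-, hz⟩, hz'⟩ := exists_forall_of_antitone (F := {z | G.Adj y z ∧ z ≠ x})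
    (P := fun n z => Far G n y z) ((hfin y).subset fun z hz => hz.1)
    (fun _ _ h => h.pred) (fun n => by
      obtain ⟨-, z, hz, hyz, h⟩ := h (n + 1)
      exact ⟨z, ⟨hyz, hz⟩, h⟩)
  exact ⟨z, hz, hz'⟩

theorem Inf.of_seq {u : ℕ → X} (hu : ∀ i, G.Adj (u i) (u (i + 1)))
    (hnb : ∀ i, u (i + 2) ≠ u i) (i : ℕ) : Inf G (u i) (u (i + 1)) := by
  intro n
  induction n generalizing i with
  | zero => exact hu i
  | succ n ih => exact ⟨hu i, u (i + 2), hnb i, hu _, ih _⟩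

theorem Inf.exists_seq (hfin : ∀ x, (G.neighborSet x).Finite) {x y : X} (h : Inf G x y) :
    ∃ u : ℕ → X, u 0 = x ∧ u 1 = y ∧ (∀ i, G.Adj (u i) (u (i + 1))) ∧ ∀ i, u (i + 2) ≠ u i := by
  choose! next hne hnext using fun x y (h : Inf G x y) => h.next hfin
  let p : ℕ → X × X := fun n => Nat.rec (x, y) (fun _ q => (q.2, next q.1 q.2)) n
  have hp : ∀ n, Inf G (p n).1 (p n).2 := by
    intro n
    induction n with
    | zero => exact h
    | succ n ih => exact hnext _ _ ih
  exact ⟨fun n => (p n).1, rfl, rfl, fun i => (hp i).adj, fun i => hne _ _ (hp i)⟩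

theorem finite_ball (hfin : ∀ x, (G.neighborSet x).Finite) (x : X) (n : ℕ) :
    {y | ∃ p : G.Walk x y, p.length ≤ n}.Finite := by
  induction n generalizing x with
  | zero =>
    refine (Set.finite_singleton x).subset ?_
    rintro y ⟨p, hp⟩
    exact (SimpleGraph.Walk.eq_of_length_eq_zero (Nat.le_zero.1 hp)).symm
  | succ n ih =>
    refine (((hfin x).biUnion fun z _ => ih z).union (Set.finite_singleton x)).subset ?_
    rintro y ⟨p, hp⟩
    cases p with
    | nil => exact Or.inr rfl
    | cons h p =>
      refine Or.inl (Set.mem_biUnion h ⟨p, ?_⟩)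
      simpa using hp

theorem Far.of_path : ∀ (n : ℕ) {x z : X} (p : G.Walk x z), p.IsPath → n + 1 ≤ p.length →
    Far G n x p.snd
  | 0, x, z, .cons h p, _, _ => by simpa [Far] using h
  | n + 1, x, z, .cons (v := v) h p, hp, hl => by
    have hp' := (SimpleGraph.Walk.cons_isPath_iff h p).1 hp
    have hl' : n + 1 ≤ p.length := by simpa using hl
    have h1 := Far.of_path n p hp'.1 hl'
    refine ⟨by simpa using h, p.snd, ?_, by simpa using h1.adj, by simpa using h1⟩
    rintro heq
    apply hp'.2
    rw [← heq]
    exact p.getVert_mem_support 1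

theorem exists_inf (hfin : ∀ x, (G.neighborSet x).Finite) {x : X}
    (hinf : {y | G.Reachable x y}.Infinite) : ∃ y, Inf G x y := by
  classical
  obtain ⟨y, -, hy⟩ := exists_forall_of_antitone (P := fun n y => Far G n x y) (hfin x)
    (fun _ _ h => h.pred) (fun n => by
      obtain ⟨z, ⟨p⟩, hz⟩ := hinf.exists_notMem_finite (finite_ball hfin x n)
      have hlen : n + 1 ≤ (p.toPath : G.Walk x z).length := by
        by_contra! h
        exact hz ⟨_, Nat.lt_succ_iff.1 h⟩
      have := Far.of_path n _ p.toPath.2 hlen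
      exact ⟨_, this.adj, this⟩)
  exact ⟨y, hy⟩

/-- The subgraph of edges which are infinite in both directions. -/
def core (G : SimpleGraph X) : SimpleGraph X where
  Adj x y := Inf G x y ∧ Inf G y x
  symm := ⟨fun _ _ h => h.symm⟩
  loopless := ⟨fun _ h => h.1.adj.ne rfl⟩

theorem core_le : core G ≤ G := fun _ _ h => h.1.adj

/-- Every edge can be prolonged. -/
def Leafless (H : SimpleGraph X) : Prop := ∀ x y, H.Adj x y → ∃ z, z ≠ x ∧ H.Adj y z

theorem core_leafless (hfin : ∀ x, (G.neighborSet x).Finite) : Leafless (core G) := by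
  intro x y h
  obtain ⟨z, hz, hyz⟩ := h.1.next hfin
  exact ⟨z, hz, hyz, h.2.cons hyz.adj.symm hz.symm⟩

end Combinatorics

/-! ### Ends -/

section Ends

open SimpleGraph

variable {V : Type*} {Γ : SimpleGraph V}

theorem end_infinite {s : (j : (Finset V)ᵒᵖ) → Γ.componentComplFunctor.obj j} (hs : s ∈ Γ.end)
    (K : Finset V) : (ComponentCompl.supp (G := Γ) (K := (K : Set V)) (s (.op K))).Infinite := by
  refine (ComponentCompl.infinite_iff_in_all_ranges (G := Γ) (K := K) (s (.op K))).mpr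
    (fun L h => ?_)
  exact ⟨s (.op L), hs (CategoryTheory.opHomOfLE h)⟩

theorem componentCompl_eq_of_mem {K : Set V} {C D : Γ.ComponentCompl K} {v : V} (hC : v ∈ C)
    (hD : v ∈ D) : C = D := by
  obtain ⟨h1, h2⟩ := hC
  obtain ⟨h3, h4⟩ := hD
  exact h2.symm.trans h4

theorem exists_end_of_ray {ρ : ℕ → V} (hρ : ∀ n, Γ.Adj (ρ n) (ρ (n + 1)))
    (hinj : Function.Injective ρ) :
    ∃ s ∈ Γ.end, ∀ K : Finset V, ∃ N, ∀ n, N ≤ n →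
      ρ n ∈ (show Γ.ComponentCompl (K : Set V) from s (.op K)) := by
  have hN : ∀ K : Finset V, ∃ N, ∀ n, N ≤ n → ρ n ∉ (K : Set V) := by
    intro K
    have hf : (ρ ⁻¹' (K : Set V)).Finite := K.finite_toSet.preimage hinj.injOn
    obtain ⟨N, hN⟩ := hf.bddAbove
    exact ⟨N + 1, fun n hn h => absurd (hN h) (by omega)⟩
  choose N hN using hN
  have hmem : ∀ (K : Finset V) (n : ℕ), N K ≤ n →
      ρ n ∈ Γ.componentComplMk (hN K (N K) le_rfl) := by
    intro K n hn
    induction n, hn using Nat.le_induction with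
    | base => exact componentComplMk_mem _ _
    | succ n hn ih => exact ComponentCompl.mem_of_adj _ _ ih (hN K _ (by omega)) (hρ n)
  refine ⟨fun K => Γ.componentComplMk (hN K.unop (N K.unop) le_rfl), ?_, fun K => ⟨N K, hmem K⟩⟩
  intro L K f
  have hKL : (K.unop : Set V) ⊆ L.unop := CategoryTheory.le_of_op_hom f
  refine componentCompl_eq_of_mem (v := ρ (max (N L.unop) (N K.unop))) ?_
    (hmem _ _ (le_max_right _ _))
  exact ComponentCompl.subset_hom _ hKL (hmem L.unop _ (le_max_left _ _))

theorem exists_seq_in_componentCompl (hfin : ∀ x, (Γ.neighborSet x).Finite) {K : Set V}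
    (C : Γ.ComponentCompl K) (hC : C.supp.Infinite) :
    ∃ u : ℕ → V, (∀ i, u i ∈ C) ∧ (∀ i, Γ.Adj (u i) (u (i + 1))) ∧ ∀ i, u (i + 2) ≠ u i := by
  let H : SimpleGraph V :=
    { Adj := fun a b => Γ.Adj a b ∧ a ∈ C ∧ b ∈ C
      symm := ⟨fun _ _ h => ⟨h.1.symm, h.2.2, h.2.1⟩⟩
      loopless := ⟨fun _ h => h.1.ne rfl⟩ }
  have hwalk : ∀ {a b : (Kᶜ : Set V)}, (Γ.induce Kᶜ).Walk a b → (a : V) ∈ C → H.Reachable a b := by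
    intro a b p
    induction p with
    | nil => exact fun _ => Reachable.refl _
    | @cons a c b h p ih =>
      intro ha
      have hadj : Γ.Adj a c := h
      have hc : (c : V) ∈ C := ComponentCompl.mem_of_adj _ _ ha c.2 hadj
      have : H.Adj a c := ⟨hadj, ha, hc⟩
      exact this.reachable.trans (ih hc)
  obtain ⟨v, hv⟩ := C.nonempty
  have hreach : C.supp ⊆ {y | H.Reachable v y} := by
    rintro w ⟨hw, hwC⟩
    obtain ⟨hv', hvC⟩ := hv
    obtain ⟨p⟩ := ConnectedComponent.exact (hvC.trans hwC.symm)
    exact hwalk p ⟨hv', hvC⟩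
  have hfin' : ∀ x, (H.neighborSet x).Finite := fun x => (hfin x).subset fun y hy => hy.1
  obtain ⟨y, hy⟩ := exists_inf hfin' (hC.mono hreach)
  obtain ⟨u, -, -, hu, hnb⟩ := hy.exists_seq hfin'
  exact ⟨u, fun i => (hu i).2.1, fun i => (hu i).1, hnb⟩

theorem avoid_of_reachable_induce {K : Set V} {a b : (Kᶜ : Set V)}
    (h : (Γ.induce Kᶜ).Reachable a b) {x : V} (hx : x ∈ K) : Avoid Γ x a b := by
  obtain ⟨p⟩ := h
  induction p with
  | nil => exact .refl (by rintro rfl; rename_i a; exact a.2 hx)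
  | @cons a c b h p ih =>
    refine Avoid.trans (.of_adj (h : Γ.Adj a c) ?_ ?_) ih
    · rintro rfl; exact a.2 hx
    · rintro rfl; exact c.2 hx

theorem ncard_end_eq_two (hfin : ∀ x, (Γ.neighborSet x).Finite) (hac : Γ.IsAcyclic) {r : ℤ → V}
    (hr : ∀ j, Γ.Adj (r j) (r (j + 1))) (hinj : Function.Injective r)
    (hit : ∀ u : ℕ → V, (∀ i, Γ.Adj (u i) (u (i + 1))) → (∀ i, u (i + 2) ≠ u i) →
      ∃ i j, u i = r j) : (Γ.end).ncard = 2 := by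
  classical
  obtain ⟨s₁, hs₁, h₁⟩ := exists_end_of_ray (Γ := Γ) (ρ := fun n : ℕ => r n)
    (fun n => by simpa using hr n) (fun a b h => by simpa using hinj h)
  obtain ⟨s₂, hs₂, h₂⟩ := exists_end_of_ray (Γ := Γ) (ρ := fun n : ℕ => r (-n))
    (fun n => by
      have := (hr (-(n : ℤ) - 1)).symm
      simpa [neg_add, sub_eq_add_neg, add_comm] using this) (fun a b h => by simpa using hinj h)
  have hkey : ∀ s ∈ Γ.end, ∀ K : Finset V, s (.op K) = s₁ (.op K) ∨ s (.op K) = s₂ (.op K) := by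
    intro s hs K
    obtain ⟨u, huC, hu, hnb⟩ := exists_seq_in_componentCompl hfin _ (end_infinite hs K)
    have huinj := seq_injective hac hu hnb
    obtain ⟨N₁, hN₁⟩ := h₁ K
    obtain ⟨N₂, hN₂⟩ := h₂ K
    let bad : Set V := r '' Set.Icc (-(N₂ : ℤ)) N₁
    have hbad : bad.Finite := (Set.finite_Icc _ _).image r
    obtain ⟨M, hM⟩ := (hbad.preimage (f := u) huinj.injOn).bddAbove
    obtain ⟨i, j, hij⟩ := hit (fun i => u (M + 1 + i)) (fun i => hu _) (fun i => hnb _)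
    have hj : j ∉ Set.Icc (-(N₂ : ℤ)) N₁ := by
      intro hj
      have : M + 1 + i ≤ M := hM (show u (M + 1 + i) ∈ bad from hij ▸ ⟨j, hj, rfl⟩)
      omega
    rw [Set.mem_Icc, not_and_or] at hj
    rcases hj with hj | hj
    · right
      have := hN₂ (-j).toNat (by omega)
      have h3 : -(((-j).toNat : ℕ) : ℤ) = j := by omega
      simp only [h3] at this
      exact componentCompl_eq_of_mem (huC (M + 1 + i)) (by rw [hij]; exact this)
    · left
      have := hN₁ j.toNat (by omega)
      have h3 : ((j.toNat : ℕ) : ℤ) = j := by omega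
      simp only [h3] at this
      exact componentCompl_eq_of_mem (huC (M + 1 + i)) (by rw [hij]; exact this)
  have hne : s₁ ≠ s₂ := by
    rintro rfl
    let K : Finset V := {r 0}
    obtain ⟨N₁, hN₁⟩ := h₁ K
    obtain ⟨N₂, hN₂⟩ := h₂ K
    have ha : ∀ n : ℕ, 1 ≤ n → Avoid Γ (r 0) (r 1) (r n) := by
      intro n hn
      induction n, hn using Nat.le_induction with
      | base => exact .refl (fun h => by simpa using hinj h)
      | succ n hn ih =>
        refine ih.trans (.of_adj (by exact_mod_cast hr n) ?_ ?_)
        · exact fun h => by have := hinj h; omega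
        · exact fun h => by have := hinj h; omega
    have hb : ∀ n : ℕ, 1 ≤ n → Avoid Γ (r 0) (r (-1)) (r (-n)) := by
      intro n hn
      induction n, hn using Nat.le_induction with
      | base => exact .refl (fun h => by have := hinj h; omega)
      | succ n hn ih =>
        refine ih.trans (.of_adj ?_ ?_ ?_)
        · have := (hr (-(n : ℤ) - 1)).symm
          simpa [neg_add, sub_eq_add_neg, add_comm] using this
        · exact fun h => by have := hinj h; omega
        · exact fun h => by have := hinj h; omega
    obtain ⟨g1, g2⟩ := hN₁ (N₁ + 1) (by omega)
    obtain ⟨g3, g4⟩ := hN₂ (N₂ + 1) (by omega)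
    have hreach := ConnectedComponent.exact (g2.trans g4.symm)
    have h0 : r 0 ∈ (K : Set V) := by simp [K]
    have h3 := avoid_of_reachable_induce hreach h0
    have h4 := ((ha (N₁ + 1) (by omega)).trans h3).trans (hb (N₂ + 1) (by omega)).symm
    have h5 : Γ.Adj (r 0) (r 1) := by simpa using hr 0
    have h6 : Γ.Adj (r 0) (r (-1)) := by simpa using (hr (-1)).symm
    have := hinj (eq_of_avoid hac h5 h6 h4)
    omega
  have : Γ.end = {s₁, s₂} := by
    ext s
    constructor
    · intro hs
      by_contra hns
      simp only [Set.mem_insert_iff, Set.mem_singleton_iff, not_or] at hns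
      obtain ⟨⟨K₁⟩, hK₁⟩ := Function.ne_iff.1 hns.1
      obtain ⟨⟨K₂⟩, hK₂⟩ := Function.ne_iff.1 hns.2
      have hl : ∀ t ∈ Γ.end, ∀ t' ∈ Γ.end, ∀ L : Finset V, L ⊆ K₁ ∪ K₂ →
          t (.op (K₁ ∪ K₂)) = t' (.op (K₁ ∪ K₂)) → t (.op L) = t' (.op L) := by
        intro t ht t' ht' L hL heq
        have hom : (Opposite.op (K₁ ∪ K₂)) ⟶ Opposite.op L := CategoryTheory.opHomOfLE hL
        rw [← ht hom, ← ht' hom, heq]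
      rcases hkey s hs (K₁ ∪ K₂) with h | h
      · exact hK₁ (hl s hs s₁ hs₁ K₁ Finset.subset_union_left h)
      · exact hK₂ (hl s hs s₂ hs₂ K₂ Finset.subset_union_right h)
    · rintro (rfl | rfl)
      exacts [hs₁, hs₂]
  rw [this, Set.ncard_pair hne]

theorem infinite_of_end_ne_empty (h : Γ.end ≠ ∅) : Infinite V := by
  by_contra hV
  rw [not_infinite_iff_finite] at hV
  obtain ⟨s, hs⟩ := Set.nonempty_iff_ne_empty.2 h
  exact end_infinite hs ∅ (Set.toFinite _)

end Ends

/-! ### Branch vertices and rays -/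

section Branch

variable {X : Type*} {G H : SimpleGraph X}

/-- `x` has at least three neighbours. -/
def Br (H : SimpleGraph X) (x : X) : Prop :=
  ∃ a b c, a ≠ b ∧ a ≠ c ∧ b ≠ c ∧ H.Adj x a ∧ H.Adj x b ∧ H.Adj x c

theorem eq_or_eq_of_not_br {x a b c : X} (h : ¬ Br H x) (hab : a ≠ b) (ha : H.Adj x a)
    (hb : H.Adj x b) (hc : H.Adj x c) : c = a ∨ c = b := by
  by_contra! hne
  exact h ⟨a, b, c, hab, hne.1.symm, hne.2.symm, ha, hb, hc⟩

/-- `y` is the first branch vertex met when leaving `x` through `u`, after `n` steps from `u`. -/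
def FirstN (H : SimpleGraph X) : ℕ → X → X → X → Prop
  | 0, x, u, y => H.Adj x u ∧ Br H u ∧ y = u
  | n + 1, x, u, y => H.Adj x u ∧ ¬ Br H u ∧ ∃ w, w ≠ x ∧ H.Adj u w ∧ FirstN H n u w y

/-- `y` is the first branch vertex met when leaving `x` through `u`. -/
def First (H : SimpleGraph X) (x u y : X) : Prop := ∃ n, FirstN H n x u y

/-- No branch vertex is met when leaving `x` through `u`. -/
def Ray (H : SimpleGraph X) (x u : X) : Prop := H.Adj x u ∧ ∀ y, ¬ First H x u y

theorem FirstN.adj {n : ℕ} {x u y : X} (h : FirstN H n x u y) : H.Adj x u := by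
  cases n with
  | zero => exact h.1
  | succ n => exact h.1

theorem FirstN.br {n : ℕ} {x u y : X} (h : FirstN H n x u y) : Br H y := by
  induction n generalizing x u with
  | zero => obtain ⟨-, h, rfl⟩ := h; exact h
  | succ n ih => obtain ⟨-, -, w, -, -, h⟩ := h; exact ih h

theorem First.br {x u y : X} (h : First H x u y) : Br H y := h.choose_spec.br

theorem First.adj {x u y : X} (h : First H x u y) : H.Adj x u := h.choose_spec.adj

theorem First.step {x u w y : X} (hxu : H.Adj x u) (hu : ¬ Br H u) (hw : w ≠ x)
    (h : First H u w y) : First H x u y := by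
  obtain ⟨n, hn⟩ := h
  exact ⟨n + 1, hxu, hu, w, hw, hn.adj, hn⟩

theorem First.of_br {x u : X} (hxu : H.Adj x u) (hu : Br H u) : First H x u u := ⟨0, hxu, hu, rfl⟩

theorem FirstN.reachable {n : ℕ} {x u y : X} (h : FirstN H n x u y) : H.Reachable x y := by
  induction n generalizing x u with
  | zero => obtain ⟨h, -, rfl⟩ := h; exact h.reachable
  | succ n ih => obtain ⟨h, -, w, -, -, h'⟩ := h; exact h.reachable.trans (ih h')

theorem First.reachable {x u y : X} (h : First H x u y) : H.Reachable x y := h.choose_spec.reachable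

theorem Ray.not_br {x u : X} (h : Ray H x u) : ¬ Br H u := fun hu => h.2 u (.of_br h.1 hu)

theorem Ray.next {x u w : X} (h : Ray H x u) (hw : w ≠ x) (huw : H.Adj u w) : Ray H u w :=
  ⟨huw, fun y hy => h.2 y (.step h.1 h.not_br hw hy)⟩

theorem Ray.cons {x u w : X} (h : Ray H u w) (hxu : H.Adj x u) (hw : w ≠ x) (hu : ¬ Br H u) :
    Ray H x u := by
  refine ⟨hxu, ?_⟩
  rintro y ⟨_ | n, hn⟩
  · exact hu hn.2.1
  · obtain ⟨-, -, v, hv, huv, hn⟩ := hn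
    rcases eq_or_eq_of_not_br hu hw h.1 hxu.symm huv with rfl | rfl
    · exact h.2 y ⟨n, hn⟩
    · exact hv rfl

theorem Ray.of_seq {u : ℕ → X} (hu : ∀ i, H.Adj (u i) (u (i + 1))) (hnb : ∀ i, u (i + 2) ≠ u i)
    (hbr : ∀ i, ¬ Br H (u i)) (i : ℕ) : Ray H (u i) (u (i + 1)) := by
  refine ⟨hu i, fun y => ?_⟩
  rintro ⟨n, hn⟩
  induction n generalizing i with
  | zero => exact hbr _ hn.2.1
  | succ n ih =>
    obtain ⟨-, -, v, hv, huv, hn⟩ := hn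
    rcases eq_or_eq_of_not_br (hbr (i + 1)) (hnb i) (hu (i + 1)) (hu i).symm huv with rfl | rfl
    · exact ih (i + 1) hn
    · exact hv rfl

/-- The vertices leaving along exactly one ray. -/
def hair (H : SimpleGraph X) : Set X := {x | ∃ y, Ray H x y ∧ ∀ z, Ray H x z → z = y}

theorem not_ray_symm_of_hair (hH : Leafless H) {x y : X} (hx : x ∈ hair H) (h : Ray H x y) :
    ¬ Ray H y x := by
  intro h'
  obtain ⟨z, hz, hxz⟩ := hH y x h.1.symm
  obtain ⟨v, -, hv⟩ := hx
  exact hz ((hv z (h'.next hz hxz)).trans (hv y h).symm)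

theorem hair_next (hH : Leafless H) {x y : X} (hx : x ∈ hair H) (h : Ray H x y) : y ∈ hair H := by
  obtain ⟨z, hz, hyz⟩ := hH x y h.1
  refine ⟨z, h.next hz hyz, fun w hw => ?_⟩
  rcases eq_or_eq_of_not_br h.not_br hz hyz h.1.symm hw.1 with rfl | rfl
  · rfl
  · exact (not_ray_symm_of_hair hH hx h hw).elim

/-- A non-branching vertex with two rays lies on a line component. -/
theorem not_br_of_two_rays (hH : Leafless H) {x y z : X} (hx : ¬ Br H x) (hyz : y ≠ z)
    (hy : Ray H x y) (hz : Ray H x z) {w : X} (hw : H.Reachable x w) :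
    ¬ Br H w ∧ ∀ v, H.Adj w v → Ray H w v := by
  have hstep : ∀ a b, (¬ Br H a ∧ ∀ v, H.Adj a v → Ray H a v) → H.Adj a b →
      (¬ Br H b ∧ ∀ v, H.Adj b v → Ray H b v) := by
    rintro a b ⟨ha, hav⟩ hab
    refine ⟨(hav b hab).not_br, fun v hbv => ?_⟩
    by_cases hva : v = a
    · subst hva
      obtain ⟨c, hc, hac⟩ := hH b v hab.symm
      exact (hav c hac).cons hab.symm hc ha
    · exact (hav b hab).next hva hbv
  obtain ⟨p⟩ := hw
  have h0 : ¬ Br H x ∧ ∀ v, H.Adj x v → Ray H x v := by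
    refine ⟨hx, fun v hv => ?_⟩
    rcases eq_or_eq_of_not_br hx hyz hy.1 hz.1 hv with rfl | rfl
    exacts [hy, hz]
  clear hx hyz hy hz
  induction p with
  | nil => exact h0
  | cons h p ih => exact ih (hstep _ _ h0 h)

/-- Off the hair, rays only occur in line components. -/
theorem not_br_of_ray (hH : Leafless H) {x y : X} (hxy : Ray H x y)
    (hh : ∀ w, H.Reachable x w → w ∉ hair H) {w : X} (hw : H.Reachable x w) : ¬ Br H w := by
  have hex : ∀ a b, Ray H a b → a ∉ hair H → ∃ c, b ≠ c ∧ Ray H a c := by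
    intro a b hab ha
    by_contra! hne
    exact ha ⟨b, hab, fun z hz => by_contra fun h => hne z (fun e => h e.symm) hz⟩
  have hyr : H.Reachable x y := hxy.1.reachable
  obtain ⟨z, hz, hyz⟩ := hH x y hxy.1
  have hray := hxy.next hz hyz
  obtain ⟨c, hc, hc'⟩ := hex y z hray (hh y hyr)
  exact (not_br_of_two_rays hH hxy.not_br hc hray hc' (hyr.symm.trans hw)).1

/-- Every edge of a leafless graph lies on a two-sided non-backtracking sequence. -/
theorem exists_line (hH : Leafless H) {x y : X} (hxy : H.Adj x y) :
    ∃ r : ℤ → X, r 0 = x ∧ (∀ j, H.Adj (r j) (r (j + 1))) ∧ ∀ j, r (j + 2) ≠ r j := by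
  have hseq : ∀ a b, H.Adj a b → ∃ u : ℕ → X, u 0 = a ∧ u 1 = b ∧
      (∀ i, H.Adj (u i) (u (i + 1))) ∧ ∀ i, u (i + 2) ≠ u i := by
    intro a b hab
    choose! next hne hnext using hH
    let p : ℕ → X × X := fun n => Nat.rec (a, b) (fun _ q => (q.2, next q.1 q.2)) n
    have hp : ∀ n, H.Adj (p n).1 (p n).2 := by
      intro n
      induction n with
      | zero => exact hab
      | succ n ih => exact hnext _ _ ih
    exact ⟨fun n => (p n).1, rfl, rfl, hp, fun i => hne _ _ (hp i)⟩
  obtain ⟨u, hu0, hu1, hu, hunb⟩ := hseq x y hxy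
  obtain ⟨z, hzy, hxz⟩ := hH y x hxy.symm
  obtain ⟨v, hv0, hv1, hv, hvnb⟩ := hseq x z hxz
  refine ⟨fun j => if 0 ≤ j then u j.toNat else v (-j).toNat, by simpa using hu0, ?_, ?_⟩
  · intro j
    rcases lt_trichotomy j (-1) with h | rfl | h
    · have h1 : (-j).toNat = (-(j + 1)).toNat + 1 := by omega
      have h2 : ¬ 0 ≤ j := by omega
      have h3 : ¬ 0 ≤ j + 1 := by omega
      simp only [h2, h3, if_false, h1]
      exact (hv _).symm
    · simp [hu0, hv1, hxz.symm]
    · have h1 : (j + 1).toNat = j.toNat + 1 := by omega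
      have h2 : 0 ≤ j := by omega
      have h3 : 0 ≤ j + 1 := by omega
      simp only [h2, h3, if_true, h1]
      exact hu _
  · intro j
    rcases lt_trichotomy j (-1) with h | rfl | h
    · by_cases h' : j = -2
      · subst h'
        have := (hvnb 0).symm
        simpa [hu0, hv0] using this
      · have h1 : (-j).toNat = (-(j + 2)).toNat + 2 := by omega
        have h2 : ¬ 0 ≤ j := by omega
        have h3 : ¬ 0 ≤ j + 2 := by omega
        simp only [h2, h3, if_false, h1]
        exact (hvnb _).symm
    · simpa [hu1, hv1] using hzy.symm
    · have h1 : (j + 2).toNat = j.toNat + 2 := by omega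
      have h2 : 0 ≤ j := by omega
      have h3 : 0 ≤ j + 2 := by omega
      simp only [h2, h3, if_true, h1]
      exact hunb _

theorem int_seq_injective (hG : G.IsAcyclic) {r : ℤ → X} (hr : ∀ j, G.Adj (r j) (r (j + 1)))
    (hnb : ∀ j, r (j + 2) ≠ r j) : Function.Injective r := by
  have hlt : ∀ i j, i < j → r i ≠ r j := by
    intro i j hij heq
    have hinj := seq_injective hG (u := fun n : ℕ => r (i + n))
      (fun n => by simpa [add_assoc] using hr (i + n))
      (fun n => by simpa [add_assoc] using hnb (i + n))
    have := @hinj 0 (j - i).toNat (by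
      have : ((j - i).toNat : ℤ) = j - i := by omega
      simp [this, heq])
    omega
  intro i j h
  by_contra hne
  rcases lt_or_gt_of_ne hne with h' | h'
  exacts [hlt _ _ h' h, hlt _ _ h' h.symm]

end Branch

/-! ### Measurability of the local notions -/

section Measurability

variable {X : Type*} [MeasurableSpace X] [StandardBorelSpace X] {G H : SimpleGraph X}

theorem measurable_eq {α : Type*} [MeasurableSpace α] {a b : α → X} (ha : Measurable a)
    (hb : Measurable b) : Measurable fun z => a z = b z := by
  let _ := upgradeStandardBorel X
  exact measurableSet_setOfPred.1 (measurableSet_eq_fun ha hb)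

theorem BorelLF.measurable_far (hG : BorelLF G) (hH : BorelGraph H) (hle : H ≤ G) (n : ℕ) :
    Measurable fun p : X × X => Far H n p.1 p.2 := by
  induction n with
  | zero => exact hH
  | succ n ih =>
    refine Measurable.and hH (hG.measurable_exists measurable_snd
      (P := fun p z => z ≠ p.1 ∧ H.Adj p.2 z ∧ Far H n p.2 z) ?_
      fun a y h => (hle h.2.1).reachable)
    exact (measurable_eq measurable_snd (measurable_fst.comp measurable_fst)).not.and
      ((hH.adj (measurable_snd.comp measurable_fst) measurable_snd).and
        (measurable_rel ih (measurable_snd.comp measurable_fst) measurable_snd))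

theorem BorelLF.measurable_inf (hG : BorelLF G) : Measurable fun p : X × X => Inf G p.1 p.2 :=
  Measurable.forall fun n => hG.measurable_far hG.borel le_rfl n

theorem BorelLF.borel_core (hG : BorelLF G) : BorelGraph (core G) :=
  Measurable.and hG.measurable_inf (measurable_rel hG.measurable_inf measurable_snd measurable_fst)

theorem BorelLF.measurable_br (hG : BorelLF G) (hH : BorelGraph H) (hle : H ≤ G) :
    Measurable (Br H) := by
  refine hG.measurable_exists measurable_id (P := fun x a => ∃ b c, a ≠ b ∧ a ≠ c ∧ b ≠ c ∧
    H.Adj x a ∧ H.Adj x b ∧ H.Adj x c) ?_ fun x a ⟨b, c, _, _, _, h, _⟩ => (hle h).reachable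
  refine hG.measurable_exists measurable_fst (P := fun (q : X × X) b => ∃ c, q.2 ≠ b ∧ q.2 ≠ c ∧
    b ≠ c ∧ H.Adj q.1 q.2 ∧ H.Adj q.1 b ∧ H.Adj q.1 c) ?_
    fun x b ⟨c, _, _, _, _, h, _⟩ => (hle h).reachable
  refine hG.measurable_exists (measurable_fst.comp measurable_fst)
    (P := fun (q : (X × X) × X) c => q.1.2 ≠ q.2 ∧ q.1.2 ≠ c ∧
      q.2 ≠ c ∧ H.Adj q.1.1 q.1.2 ∧ H.Adj q.1.1 q.2 ∧ H.Adj q.1.1 c) ?_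
    fun x c ⟨_, _, _, _, _, h⟩ => (hle h).reachable
  have h1 : Measurable fun q : ((X × X) × X) × X => q.1.1.1 := by fun_prop
  have h2 : Measurable fun q : ((X × X) × X) × X => q.1.1.2 := by fun_prop
  have h3 : Measurable fun q : ((X × X) × X) × X => q.1.2 := by fun_prop
  have h4 : Measurable fun q : ((X × X) × X) × X => q.2 := by fun_prop
  exact (measurable_eq h2 h3).not.and <| (measurable_eq h2 h4).not.and <|
    (measurable_eq h3 h4).not.and <| (hH.adj h1 h2).and <| (hH.adj h1 h3).and (hH.adj h1 h4)

theorem BorelLF.measurable_first (hG : BorelLF G) (hH : BorelGraph H) (hle : H ≤ G) :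
    Measurable fun p : X × X × X => First H p.1 p.2.1 p.2.2 := by
  have hbr := hG.measurable_br hH hle
  refine Measurable.exists fun n => ?_
  induction n with
  | zero =>
    exact (hH.adj measurable_fst (by fun_prop)).and
      ((hbr.comp (by fun_prop)).and (measurable_eq (by fun_prop) (by fun_prop)))
  | succ n ih =>
    refine (hH.adj measurable_fst (by fun_prop)).and
      ((hbr.comp (g := Br H) (by fun_prop)).not.and ?_)
    refine hG.measurable_exists (b := fun p : X × X × X => p.2.1) (by fun_prop)
      (P := fun (p : X × X × X) w => w ≠ p.1 ∧ H.Adj p.2.1 w ∧ FirstN H n p.2.1 w p.2.2) ?_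
      fun a y h => (hle h.2.1).reachable
    refine (measurable_eq (by fun_prop) (by fun_prop)).not.and
      ((hH.adj (by fun_prop) (by fun_prop)).and ?_)
    have : Measurable fun q : (X × X × X) × X => (q.1.2.1, q.2, q.1.2.2) := by fun_prop
    exact ih.comp this

theorem BorelLF.measurable_ray (hG : BorelLF G) (hH : BorelGraph H) (hle : H ≤ G) :
    Measurable fun p : X × X => Ray H p.1 p.2 := by
  refine Measurable.and hH (hG.measurable_forall measurable_fst
    (P := fun (p : X × X) y => ¬ First H p.1 p.2 y) ?_
    fun a y h => (not_not.1 h).reachable.mono hle)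
  have : Measurable fun q : (X × X) × X => (q.1.1, q.1.2, q.2) := by fun_prop
  exact ((hG.measurable_first hH hle).comp this).not

theorem BorelLF.measurableSet_hair (hG : BorelLF G) (hH : BorelGraph H) (hle : H ≤ G) :
    MeasurableSet (hair H) := by
  have hr := hG.measurable_ray hH hle
  refine measurableSet_setOfPred.2 (hG.measurable_exists measurable_id
    (P := fun x y => Ray H x y ∧ ∀ z, Ray H x z → z = y) (hr.and ?_)
    fun a y h => (hle h.1.1).reachable)
  refine hG.measurable_forall measurable_fst (P := fun (p : X × X) z => Ray H p.1 z → z = p.2)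
    ((measurable_rel hr (by fun_prop) (by fun_prop)).imp (measurable_eq (by fun_prop) (by fun_prop)))
    fun a y h => ?_
  push Not at h
  exact (hle h.1.1).reachable

theorem Flow.of_hair (hG : BorelLF G) (hH : BorelGraph H) (hle : H ≤ G) (hl : Leafless H) :
    Flow G {x | ∃ a ∈ hair H, G.Reachable x a} := by
  obtain ⟨f, hf, hf'⟩ := hG.exists_selector measurable_id (hG.measurable_ray hH hle)
    fun a y h => (hle h.1).reachable
  have hray : ∀ x ∈ hair H, Ray H x (f x) := fun x hx => hf' x ⟨_, hx.choose_spec.1⟩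
  refine Flow.of_complete_section hG (hG.measurableSet_hair hH hle) hf
    (fun x hx => hle (hray x hx).1) (fun x hx => hair_next hl hx (hray x hx)) ?_
  rintro ⟨u, hu, hu'⟩
  have hback : ∀ i, Ray H (u (i + 1)) (u i) := fun i => by
    have := hray _ (hu (i + 1)); rwa [hu' i] at this
  have hnb : ∀ i, u (i + 2) ≠ u i := by
    intro i heq
    have := hback (i + 1)
    rw [show i + 1 + 1 = i + 2 from rfl, heq] at this
    exact not_ray_symm_of_hair hl (hu (i + 1)) (hback i) this
  exact not_ray_symm_of_hair hl (hu 1) (hback 0)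
    (Ray.of_seq (fun i => (hback i).1.symm) hnb (fun i => (hback i).not_br) 0)

theorem Flow.of_no_core (hG : BorelLF G) (hinf : ∀ x, {y | G.Reachable x y}.Infinite) :
    Flow G {x | ∀ y, G.Reachable x y → y ∉ supp (core G)} := by
  obtain ⟨f, hf, hf'⟩ := hG.exists_selector measurable_id hG.measurable_inf
    fun a y h => h.adj.reachable
  have hfinf : ∀ x, Inf G x (f x) := fun x => hf' x (exists_inf hG.finite (hinf x))
  refine ⟨f, hf, fun x _ => (hfinf x).adj, ?_⟩
  rintro ⟨u, hu, hu'⟩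
  have hback : ∀ i, Inf G (u (i + 1)) (u i) := fun i => by
    have := hfinf (u (i + 1)); rwa [hu' i] at this
  have hno : ∀ i, ¬ Inf G (u i) (u (i + 1)) := fun i h =>
    hu i (u i) (.refl _) ⟨u (i + 1), h, hback i⟩
  have hnb : ∀ i, u (i + 2) ≠ u i := by
    intro i heq
    have := hback (i + 1)
    rw [show i + 1 + 1 = i + 2 from rfl, heq] at this
    exact hno i this
  exact hno 0 (Inf.of_seq (fun i => (hback i).adj.symm) hnb 0)

/-- The core has no line component whose component in `G` does not have exactly two ends. -/
theorem false_of_core_line (hG : BorelLF G) (hac : G.IsAcyclic)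
    (hends : ∀ c : G.ConnectedComponent, (SimpleGraph.end (G.induce c.supp)).ncard ≠ 2)
    {r : ℤ → X} (hr : ∀ j, (core G).Adj (r j) (r (j + 1))) (hnb : ∀ j, r (j + 2) ≠ r j)
    (hbr : ∀ j, ¬ Br (core G) (r j)) : False := by
  have hinj := int_seq_injective hac (fun j => core_le (hr j)) hnb
  let c : G.ConnectedComponent := G.connectedComponentMk (r 0)
  have hreach : ∀ j, G.Reachable (r j) (r 0) := by
    intro j
    induction j using Int.induction_on with
    | zero => exact .refl _
    | succ i ih => exact (core_le (hr i)).reachable.symm.trans ih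
    | pred i ih =>
      have := hr (-i - 1)
      rw [sub_add_cancel] at this
      exact (core_le this).reachable.trans ih
  have hmem : ∀ j, r j ∈ c.supp := fun j => SimpleGraph.ConnectedComponent.sound (hreach j)
  refine hends c (ncard_end_eq_two (Γ := G.induce c.supp) (r := fun j => ⟨r j, hmem j⟩)
    (fun x => ?_) ?_ (fun j => show G.Adj _ _ from core_le (hr j)) (fun i j h => hinj (congrArg Subtype.val h)) ?_)
  · refine Set.Finite.of_finite_image (f := Subtype.val) ((hG.finite x).subset ?_)
      Subtype.val_injective.injOn
    rintro _ ⟨y, hy, rfl⟩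
    exact hy
  · exact hac.induce _
  · intro u hu hunb
    by_contra! hno
    let A : Set X := Set.range fun i => (u i : X)
    have hA : MeasurableSet A := by
      let _ := upgradeStandardBorel X
      exact (Set.countable_range _).measurableSet
    obtain ⟨d, -, hd⟩ := exists_rank hG hG.borel le_rfl hA
    have hcon : ∀ x, G.Reachable x (r 0) → ∃ a ∈ A, G.Reachable x a := fun x hx =>
      ⟨u 0, ⟨0, rfl⟩, hx.trans (SimpleGraph.ConnectedComponent.exact (u 0).2).symm⟩
    have huInf : ∀ i, Inf G (u i : X) (u (i + 1)) := fun i =>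
      Inf.of_seq (u := fun i => (u i : X)) (fun i => hu i)
        (fun i h => hunb i (Subtype.ext h)) i
    have hInf : ∀ n v v', G.Adj v v' → G.Reachable v (r 0) → v ∉ A → d v' < d v → d v' ≤ n →
        Inf G v v' := by
      intro n
      induction n with
      | zero =>
        intro v v' hvv' hv hvA hlt hn
        by_cases hv'A : v' ∈ A
        · obtain ⟨i, rfl⟩ := hv'A
          exact (huInf i).cons hvv' fun h => hvA ⟨i + 1, h⟩
        · obtain ⟨v'', h1, h2⟩ := hd v' hv'A (hcon _ (hvv'.reachable.symm.trans hv))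
          omega
      | succ n ih =>
        intro v v' hvv' hv hvA hlt hn
        have hv' := hvv'.reachable.symm.trans hv
        by_cases hv'A : v' ∈ A
        · obtain ⟨i, rfl⟩ := hv'A
          exact (huInf i).cons hvv' fun h => hvA ⟨i + 1, h⟩
        · obtain ⟨v'', h1, h2⟩ := hd v' hv'A (hcon _ hv')
          exact (ih v' v'' h1 hv' hv'A h2 (by omega)).cons hvv' (by rintro rfl; omega)
    have hrA : ∀ j, r j ∉ A := by
      rintro j ⟨i, hi⟩
      exact hno i j (Subtype.ext hi)
    obtain ⟨j, hj⟩ : ∃ j, ∀ k, d (r j) ≤ d (r k) := by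
      obtain ⟨j, hj⟩ := Nat.sInf_mem (Set.range_nonempty fun j => d (r j))
      exact ⟨j, fun k => by simp only at hj; rw [hj]; exact Nat.sInf_le ⟨k, rfl⟩⟩
    obtain ⟨v', hv', hlt⟩ := hd (r j) (hrA j) (hcon _ (hreach j))
    have hv'r : ∀ k, v' ≠ r k := by
      rintro k rfl
      exact absurd (hj k) (by omega)
    have h1 := hInf _ _ _ hv' (hreach j) (hrA j) hlt le_rfl
    have h2 : Inf G v' (r j) := (hr j).1.cons hv'.symm (hv'r _).symm
    have h3 := hr (j - 1)
    rw [sub_add_cancel] at h3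
    refine hbr j ⟨r (j - 1), r (j + 1), v', fun h => ?_, (hv'r _).symm, (hv'r _).symm, h3.symm, hr j,
      h1, h2⟩
    have := hinj h
    omega

end Measurability

/-! ### Probing all finite chains by disjoint families -/

section Probes

variable {X : Type*} [MeasurableSpace X] [StandardBorelSpace X] {G H : SimpleGraph X}

/-- A sequence of Borel families of pairwise disjoint chains which meets every finite chain
infinitely often. -/
structure Probes (G : SimpleGraph X) where
  /-- The length of the chains of the `n`-th family. -/
  len : ℕ → ℕ
  /-- The `i`-th vertex of the chain of the `n`-th family starting at `x`. -/
  run : ℕ → ℕ → X → X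
  /-- The starting points of the chains of the `n`-th family. -/
  sel : ℕ → Set X
  measurable_run : ∀ n i, Measurable (run n i)
  measurableSet_sel : ∀ n, MeasurableSet (sel n)
  run_zero : ∀ n x, run n 0 x = x
  disj : ∀ n, ∀ x ∈ sel n, ∀ y ∈ sel n, ∀ i ≤ len n, ∀ j ≤ len n, run n i x = run n j y → x = y
  hits : ∀ (k : ℕ) (v : ℕ → X), (∀ i < k, G.Adj (v i) (v (i + 1))) → ∀ N, ∃ n, N ≤ n ∧ len n = k ∧
    v 0 ∈ sel n ∧ ∀ i ≤ k, run n i (v 0) = v i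

theorem BorelLF.exists_probes (hG : BorelLF G) : Nonempty (Probes G) := by
  obtain ⟨g, hg, hgadj, hgcov⟩ := hG.exists_steps
  let run : List ℕ → ℕ → X → X := fun s i => Nat.rec id (fun i φ => g (s.getD i 0) ∘ φ) i
  have hrm : ∀ s i, Measurable (run s i) := by
    intro s i
    induction i with
    | zero => exact measurable_id
    | succ i ih => exact (hg _).comp ih
  have hwalk : ∀ s i x, ∃ p : G.Walk x (run s i x), p.length ≤ i := by
    intro s i x
    induction i with
    | zero => exact ⟨.nil, le_rfl⟩
    | succ i ih =>
      obtain ⟨p, hp⟩ := ih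
      have hsucc : run s (i + 1) x = g (s.getD i 0) (run s i x) := rfl
      rcases hgadj (s.getD i 0) (run s i x) with h | h
      · rw [hsucc, h]; exact ⟨p, by omega⟩
      · rw [hsucc]
        exact ⟨p.concat h, by rw [SimpleGraph.Walk.length_concat]; omega⟩
  let R : List ℕ → X → X → Prop := fun s x y =>
    x ≠ y ∧ ∃ i j, (i ≤ s.length ∧ j ≤ s.length) ∧ run s i x = run s j y
  have hcol : ∀ s, ∃ col : X → ℕ, Measurable col ∧ ∀ x y, R s x y → col x ≠ col y := by
    intro s
    refine hG.exists_coloring ?_ ?_ ?_ ?_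
    · refine (measurable_eq measurable_fst measurable_snd).not.and <| Measurable.exists fun i =>
        Measurable.exists fun j => measurable_const.and ?_
      exact measurable_eq ((hrm s i).comp measurable_fst) ((hrm s j).comp measurable_snd)
    · rintro x y ⟨-, i, j, -, h⟩
      obtain ⟨p, -⟩ := hwalk s i x
      obtain ⟨q, -⟩ := hwalk s j y
      exact p.reachable.trans (h ▸ q.reachable.symm)
    · intro x
      refine ((Set.finite_Iic s.length).biUnion fun i _ =>
        finite_ball hG.finite (run s i x) s.length).subset ?_
      rintro y ⟨-, i, j, ⟨hi, hj⟩, h⟩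
      obtain ⟨q, hq⟩ := hwalk s j y
      refine Set.mem_biUnion (show i ∈ Set.Iic s.length from hi) ?_
      rw [h]
      exact ⟨q.reverse, by simpa using hq.trans hj⟩
    · exact fun x h => h.1 rfl
  choose col hcolm hcol using hcol
  let e : ℕ → List ℕ × ℕ := fun n =>
    (Encodable.decode (α := List ℕ × ℕ) (Nat.unpair n).1).getD ([], 0)
  refine ⟨⟨fun n => (e n).1.length, fun n => run (e n).1, fun n => {x | col (e n).1 x = (e n).2},
    fun n i => hrm _ i, fun n => ?_, fun n x => rfl, ?_, ?_⟩⟩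
  · exact hcolm _ (measurableSet_singleton _)
  · intro n x hx y hy i hi j hj h
    by_contra hne
    exact hcol _ x y ⟨hne, i, j, ⟨hi, hj⟩, h⟩ (Eq.trans hx (Eq.symm hy))
  · intro k v hv N
    have hc : ∀ i, ∃ n, i < k → g n (v i) = v (i + 1) := fun i => by
      by_cases hi : i < k
      · obtain ⟨n, hn⟩ := hgcov _ _ (hv i hi); exact ⟨n, fun _ => hn⟩
      · exact ⟨0, fun h => (hi h).elim⟩
    choose c hc using hc
    let s := (List.range k).map c
    have hs : s.length = k := by simp [s]
    let n := Nat.pair (Encodable.encode (s, col s (v 0))) N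
    have hen : e n = (s, col s (v 0)) := by simp only [e, n, Nat.unpair_pair, Encodable.encodek]; rfl
    refine ⟨n, Nat.right_le_pair _ _, by rw [hen]; exact hs, ?_, ?_⟩
    · change col (e n).1 (v 0) = (e n).2
      rw [hen]
    · rw [hen]
      intro i
      induction i with
      | zero => exact fun _ => rfl
      | succ i ih =>
        intro hi
        change g (s.getD i 0) (run s i (v 0)) = _
        rw [ih (by omega)]
        have : s.getD i 0 = c i := by simp [s, List.getD, show i < k by omega]
        rw [this, hc i (by omega)]

end Probes

/-! ### Contracted edges -/

section Contracted

variable {X : Type*} {G H K : SimpleGraph X}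

theorem FirstN.exists_chain {n : ℕ} {x u y : X} (h : FirstN H n x u y) :
    ∃ v : ℕ → X, v 0 = x ∧ v 1 = u ∧ v (n + 1) = y ∧ (∀ i < n + 1, H.Adj (v i) (v (i + 1))) ∧
      (∀ i, i < n → v (i + 2) ≠ v i) ∧ ∀ i, 0 < i → i < n + 1 → ¬ Br H (v i) := by
  induction n generalizing x u with
  | zero =>
    obtain ⟨h, -, rfl⟩ := h
    exact ⟨fun i => if i = 0 then x else y, by simp, by simp, by simp, fun i hi => by
      obtain rfl : i = 0 := by omega
      simpa using h, fun i hi => by omega, fun i hi hi' => by omega⟩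
  | succ n ih =>
    obtain ⟨hxu, hu, w, hw, huw, h⟩ := h
    obtain ⟨v, hv0, hv1, hvn, hadj, hnb, hbr⟩ := ih h
    refine ⟨fun i => Nat.casesOn i x v, rfl, hv0, hvn, ?_, ?_, ?_⟩
    · rintro (_ | i) hi
      · change H.Adj x (v 0); rwa [hv0]
      · exact hadj i (by omega)
    · rintro (_ | i) hi
      · change v 1 ≠ x; rwa [hv1]
      · exact hnb i (by omega)
    · rintro (_ | _ | i) h0 hi
      · omega
      · change ¬ Br H (v 0); rwa [hv0]
      · exact hbr (i + 1) (by omega) (by omega)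

theorem First.unique {x u y z : X} (h : First H x u y) (h' : First H x u z) : y = z := by
  obtain ⟨n, h⟩ := h
  obtain ⟨m, h'⟩ := h'
  induction n generalizing x u m with
  | zero =>
    obtain ⟨-, hu, rfl⟩ := h
    cases m with
    | zero => exact h'.2.2.symm
    | succ m => exact (h'.2.1 hu).elim
  | succ n ih =>
    obtain ⟨hxu, hu, w, hw, huw, h⟩ := h
    cases m with
    | zero => exact (hu h'.2.1).elim
    | succ m =>
      obtain ⟨-, -, w', hw', huw', h'⟩ := h'
      rcases eq_or_eq_of_not_br hu hw huw hxu.symm huw' with rfl | rfl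
      exacts [ih h m h', (hw' rfl).elim]

theorem First.eq_of_br {x u y : X} (h : First H x u y) (hu : Br H u) : y = u :=
  h.unique (.of_br h.adj hu)

theorem First.tail {x u w y : X} (h : First H x u y) (hu : ¬ Br H u) (hw : w ≠ x)
    (huw : H.Adj u w) : First H u w y := by
  obtain ⟨_ | n, h⟩ := h
  · exact (hu h.2.1).elim
  · obtain ⟨hxu, -, w', hw', huw', h⟩ := h
    rcases eq_or_eq_of_not_br hu hw' huw' hxu.symm huw with rfl | rfl
    exacts [⟨n, h⟩, (hw rfl).elim]

theorem First.of_le (hle : K ≤ H) (hbr : ∀ x, Br H x → Br K x) {x u y : X} (h : First K x u y) :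
    First H x u y := by
  have hmono : ∀ x, Br K x → Br H x := fun x ⟨a, b, c, h1, h2, h3, ha, hb, hc⟩ =>
    ⟨a, b, c, h1, h2, h3, hle ha, hle hb, hle hc⟩
  obtain ⟨n, h⟩ := h
  induction n generalizing x u with
  | zero => obtain ⟨h, hu, rfl⟩ := h; exact .of_br (hle h) (hmono _ hu)
  | succ n ih =>
    obtain ⟨hxu, hu, w, hw, -, h⟩ := h
    exact .step (hle hxu) (fun h => hu (hbr _ h)) hw (ih h)

theorem First.ne (hac : H.IsAcyclic) {x u y : X} (h : First H x u y) : x ≠ y := by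
  obtain ⟨n, h⟩ := h
  obtain ⟨v, rfl, -, rfl, hadj, hnb, -⟩ := h.exists_chain
  exact chain_ne hac hadj (fun i hi => hnb i (by omega)) 0 (n + 1) (by omega) le_rfl

theorem First.avoid_left (hac : H.IsAcyclic) {x u y : X} (h : First H x u y) : Avoid H x u y := by
  obtain ⟨n, h⟩ := h
  obtain ⟨v, rfl, rfl, rfl, hadj, hnb, -⟩ := h.exists_chain
  exact .of_chain hadj (by omega) le_rfl fun i hi hi' =>
    chain_ne hac hadj (fun i hi => hnb i (by omega)) 0 i (by omega) hi'

theorem First.avoid_br {x p q r : X} (h : First H p q r) (hx : Br H x) (hp : x ≠ p) (hr : x ≠ r) :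
    Avoid H x p r := by
  obtain ⟨n, h⟩ := h
  obtain ⟨v, rfl, rfl, rfl, hadj, hnb, hbr⟩ := h.exists_chain
  refine .of_chain hadj (by omega) le_rfl fun i _ hi' => ?_
  rcases Nat.eq_zero_or_pos i with rfl | h0
  · exact hp
  rcases hi'.eq_or_lt with rfl | h1
  · exact hr
  · rintro rfl
    exact hbr i h0 h1 hx

theorem First.inj (hac : H.IsAcyclic) {x u v y : X} (hu : First H x u y) (hv : First H x v y) :
    u = v :=
  eq_of_avoid hac hu.adj hv.adj ((hu.avoid_left hac).trans (hv.avoid_left hac).symm)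

/-- With a contracted edge, `K` contains all its edges or none of them. -/
def Saturated (H K : SimpleGraph X) : Prop :=
  ∀ u v w, ¬ Br H v → H.Adj v w → u ≠ w → K.Adj u v → K.Adj v w

theorem First.saturated (hle : K ≤ H) (hs : Saturated H K) {x u y : X} (h : First H x u y)
    (hK : K.Adj x u) : ∃ w, K.Adj y w ∧ (∀ t, First H u x t → First H y w t) ∧
      (Br K y → First K x u y) ∧ ∀ v t, ¬ Br K y → v ≠ w → First K y v t → First K x u t := by
  have hmono : ∀ x, Br K x → Br H x := fun x ⟨a, b, c, h1, h2, h3, ha, hb, hc⟩ =>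
    ⟨a, b, c, h1, h2, h3, hle ha, hle hb, hle hc⟩
  obtain ⟨n, h⟩ := h
  induction n generalizing x u with
  | zero =>
    obtain ⟨hxu, hu, rfl⟩ := h
    exact ⟨x, hK.symm, fun t ht => ht, fun hb => .of_br hK hb, fun v t hb hv ht => .step hK hb hv ht⟩
  | succ n ih =>
    obtain ⟨hxu, hu, w', hw', huw', h⟩ := h
    obtain ⟨w, hw, h1, h2, h3⟩ := ih (hs x u w' hu huw' hw'.symm hK) h
    have hu' : ¬ Br K u := fun h => hu (hmono _ h)
    exact ⟨w, hw, fun t ht => h1 t (.step huw'.symm hu hw'.symm ht),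
      fun hb => .step hK hu' hw' (h2 hb), fun v t hb hv ht => .step hK hu' hw' (h3 v t hb hv ht)⟩

theorem First.symm {x u y : X} (h : First H x u y) (hx : Br H x) : ∃ w, First H y w x := by
  obtain ⟨w, -, hw, -⟩ := h.saturated le_rfl (fun _ _ _ _ h _ _ => h) h.adj
  exact ⟨w, hw x (.of_br h.adj.symm hx)⟩

/-- A leafless graph in which one meets a branch vertex in every direction. -/
structure Ample (H : SimpleGraph X) : Prop where
  leafless : Leafless H
  exists_first : ∀ x u, H.Adj x u → ∃ y, First H x u y

theorem Ample.of_saturated (hH : Ample H) (hle : K ≤ H) (hs : Saturated H K)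
    (hb : ∀ x ∈ supp K, Br H x → ∀ w, ∃ v, v ≠ w ∧ K.Adj x v)
    (hc : ∀ x v y, Br H x → ¬ Br K x → K.Adj x v → First H x v y → Br K y) : Ample K := by
  constructor
  · intro x y hxy
    by_cases hy : Br H y
    · exact hb y ⟨x, hxy.symm⟩ hy x
    · obtain ⟨z, hz, hyz⟩ := hH.leafless x y (hle hxy)
      exact ⟨z, hz, hs x y z hy hyz hz.symm hxy⟩
  · intro x u hxu
    obtain ⟨y, hy⟩ := hH.exists_first x u (hle hxu)
    obtain ⟨w, hw, -, h1, h2⟩ := hy.saturated hle hs hxu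
    by_cases hyb : Br K y
    · exact ⟨y, h1 hyb⟩
    · obtain ⟨v, hv, hyv⟩ := hb y ⟨w, hw⟩ hy.br w
      obtain ⟨z, hz⟩ := hH.exists_first y v (hle hyv)
      obtain ⟨-, -, -, h3, -⟩ := hz.saturated hle hs hyv
      exact ⟨z, h2 v z hyb hv (h3 (hc y v z hy.br hyb hyv hz))⟩

/-- The graph `H` without the contracted edges whose ends are related by `Q`. -/
def prune (H : SimpleGraph X) (Q : X → X → Prop) : SimpleGraph X where
  Adj u v := H.Adj u v ∧ ∀ y z, First H u v y → First H v u z → ¬ Q y z ∧ ¬ Q z y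
  symm := ⟨fun _ _ h => ⟨h.1.symm, fun y z hy hz => (h.2 z y hz hy).symm⟩⟩
  loopless := ⟨fun _ h => h.1.ne rfl⟩

variable {Q : X → X → Prop}

theorem prune_le : prune H Q ≤ H := fun _ _ h => h.1

theorem prune_adj {x u y : X} (hx : Br H x) (h : First H x u y) :
    (prune H Q).Adj x u ↔ ¬ Q x y ∧ ¬ Q y x := by
  refine ⟨fun h' => (h'.2 y x h (.of_br h.adj.symm hx)).symm, fun h' => ⟨h.adj, fun y' z hy hz => ?_⟩⟩
  obtain rfl := h.unique hy
  obtain rfl := hz.eq_of_br hx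
  exact h'.symm

theorem prune_saturated : Saturated H (prune H Q) := by
  intro u v w hv hvw hne huv
  refine ⟨hvw, fun y z hy hz => huv.2 y z (.step huv.1 hv hne.symm hy) ?_⟩
  exact hz.tail hv hne huv.1.symm

end Contracted

section MeasurePrune

variable {X : Type*} [MeasurableSpace X] [StandardBorelSpace X] {G H : SimpleGraph X}

theorem BorelLF.borel_prune (hG : BorelLF G) (hH : BorelGraph H) (hle : H ≤ G) {Q : X → X → Prop}
    (hQ : Measurable fun p : X × X => Q p.1 p.2) : BorelGraph (prune H Q) := by
  have hf := hG.measurable_first hH hle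
  refine Measurable.and hH (hG.measurable_forall measurable_fst
    (P := fun (p : X × X) y => ∀ z, First H p.1 p.2 y → First H p.2 p.1 z → ¬ Q y z ∧ ¬ Q z y) ?_
    fun a y h => ?_)
  · refine hG.measurable_forall (b := fun q : (X × X) × X => q.1.2) (by fun_prop)
      (P := fun (q : (X × X) × X) z =>
        First H q.1.1 q.1.2 q.2 → First H q.1.2 q.1.1 z → ¬ Q q.2 z ∧ ¬ Q z q.2) ?_ fun a y h => ?_
    · have h1 : Measurable fun q : ((X × X) × X) × X => (q.1.1.1, q.1.1.2, q.1.2) := by fun_prop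
      have h2 : Measurable fun q : ((X × X) × X) × X => (q.1.1.2, q.1.1.1, q.2) := by fun_prop
      exact (hf.comp h1).imp ((hf.comp h2).imp
        ((measurable_rel hQ (by fun_prop) (by fun_prop)).not.and
          (measurable_rel hQ (by fun_prop) (by fun_prop)).not))
    · push Not at h
      exact h.2.1.reachable.mono hle
  · push Not at h
    obtain ⟨-, h, -⟩ := h
    exact h.reachable.mono hle

end MeasurePrune

/-! ### Bounded colourings and selection of tuples -/

section Coloring

variable {X : Type*} [MeasurableSpace X] [StandardBorelSpace X] {G H : SimpleGraph X}

/-- A symmetric Borel relation on the components of `G` of bounded degree has a bounded Borel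
colouring. -/
theorem BorelLF.exists_bounded_coloring (hG : BorelLF G) {R : X → X → Prop}
    (hR : Measurable fun p : X × X => R p.1 p.2) (hreach : ∀ x y, R x y → G.Reachable x y)
    (hirr : ∀ x, ¬ R x x) (hsymm : ∀ x y, R x y → R y x) {ι : Type*} [Fintype ι]
    (hcov : ∀ x, ∃ e : ι → X, ∀ y, R x y → ∃ i, e i = y) :
    ∃ c : X → ℕ, Measurable c ∧ (∀ x, c x ≤ Fintype.card ι) ∧ ∀ x y, R x y → c x ≠ c y := by
  classical
  have hfin : ∀ x, {y | R x y}.Finite := fun x => by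
    obtain ⟨e, he⟩ := hcov x
    exact (Set.finite_range e).subset he
  obtain ⟨col, hcol, hcol'⟩ := hG.exists_coloring hR hreach hfin hirr
  have hstep : ∀ (n : ℕ) (f : {f : X → ℕ // Measurable f}), ∃ f' : {f : X → ℕ // Measurable f},
      ∀ x, (col x = n → f'.1 x ≤ Fintype.card ι ∧ ∀ y, R x y → col y < n → f.1 y ≠ f'.1 x) ∧
        (col x ≠ n → f'.1 x = f.1 x) := by
    rintro n ⟨f, hf⟩
    obtain ⟨φ, hφ, hφ'⟩ := exists_measurable_least
      (P := fun x k => ∀ y, R x y → col y < n → f y ≠ k) fun k => by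
        refine hG.measurable_forall measurable_id (hR.imp (Measurable.imp ?_ ?_)) fun a y h => ?_
        · exact measurableSet_setOfPred.1
            (measurableSet_lt (hcol.comp measurable_snd) measurable_const)
        · exact (measurableSet_setOfPred.1
            (measurableSet_eq_fun (hf.comp measurable_snd) measurable_const)).not
        · push Not at h
          exact hreach _ _ h.1
    have hex : ∀ x, ∃ k ≤ Fintype.card ι, ∀ y, R x y → col y < n → f y ≠ k := by
      intro x
      by_contra! hno
      obtain ⟨e, he⟩ := hcov x
      have hno' : ∀ k : Fin (Fintype.card ι + 1), ∃ i, f (e i) = k := fun k => by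
        obtain ⟨y, hy, -, hk⟩ := hno k (by omega)
        obtain ⟨i, rfl⟩ := he y hy
        exact ⟨i, hk⟩
      choose i hi using hno'
      have hinj : Function.Injective i := fun k l h => Fin.ext (by rw [← hi, ← hi, h])
      have := Fintype.card_le_of_injective i hinj
      simp at this
    refine ⟨⟨fun x => if col x = n then φ x else f x,
      Measurable.ite (hcol (measurableSet_singleton n)) hφ hf⟩, fun x => ⟨fun h => ?_, fun h => ?_⟩⟩
    · obtain ⟨k, hk, hk'⟩ := hex x
      obtain ⟨h1, h2⟩ := hφ' x ⟨k, hk'⟩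
      simp only [h, if_true]
      exact ⟨(h2 k hk').trans hk, h1⟩
    · simp [h]
  choose next hnext using hstep
  let F : ℕ → {f : X → ℕ // Measurable f} := fun n => Nat.rec ⟨fun _ => 0, measurable_const⟩ next n
  have hF : ∀ n, F (n + 1) = next n (F n) := fun n => rfl
  have hstable : ∀ x m, col x + 1 ≤ m → (F m).1 x = (F (col x + 1)).1 x := by
    intro x m hm
    induction m, hm using Nat.le_induction with
    | base => rfl
    | succ m hm ih => rw [hF, (hnext m (F m) x).2 (by omega), ih]
  have hlt : ∀ x y, R x y → col y < col x → (F (col x + 1)).1 x ≠ (F (col y + 1)).1 y := by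
    intro x y hxy h
    rw [← hstable y (col x) h, hF]
    exact (((hnext _ (F (col x)) x).1 rfl).2 y hxy h).symm
  refine ⟨fun x => (F (col x + 1)).1 x, ?_, fun x => ?_, fun x y hxy => ?_⟩
  · have : Measurable fun p : ℕ × X => (F (p.1 + 1)).1 p.2 :=
      measurable_from_prod_countable_right fun n => (F (n + 1)).2
    exact this.comp (hcol.prodMk measurable_id)
  · simp only [hF]
    exact ((hnext _ (F (col x)) x).1 rfl).1
  · rcases lt_or_gt_of_ne (hcol' x y hxy) with h | h
    exacts [(hlt y x (hsymm _ _ hxy) h).symm, hlt x y hxy h]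

variable {k : ℕ}

theorem BorelLF.exists_tuple_moves (hG : BorelLF G) (k : ℕ) :
    ∃ h : ℕ → X → Fin k → X, (∀ n, Measurable (h n)) ∧
      ∀ x v, (∀ i, G.Reachable x (v i)) → ∃ n, h n x = v := by
  obtain ⟨h, hh, hcov⟩ := hG.exists_moves
  refine ⟨fun n x i => h ((Encodable.decode (α := Fin k → ℕ) n).getD 0 i) x, fun n => ?_, ?_⟩
  · exact measurable_pi_lambda _ fun i => hh _
  · intro x v hv
    choose s hs using fun i => hcov x (v i) (hv i)
    exact ⟨Encodable.encode s, by funext i; simpa using hs i⟩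

theorem BorelLF.measurable_exists_tuple (hG : BorelLF G) {P : X → (Fin k → X) → Prop}
    (hP : Measurable fun q : X × (Fin k → X) => P q.1 q.2)
    (hr : ∀ x v, P x v → ∀ i, G.Reachable x (v i)) : Measurable fun x => ∃ v, P x v := by
  obtain ⟨h, hh, hcov⟩ := hG.exists_tuple_moves k
  have : (fun x => ∃ v, P x v) = fun x => ∃ n, P x (h n x) := by
    funext x
    refine propext ⟨fun ⟨v, hv⟩ => ?_, fun ⟨n, hn⟩ => ⟨_, hn⟩⟩
    obtain ⟨n, rfl⟩ := hcov _ _ (hr x v hv)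
    exact ⟨n, hv⟩
  rw [this]
  exact Measurable.exists fun n => Measurable.comp (g := fun q : X × (Fin k → X) => P q.1 q.2) hP
    (measurable_id.prodMk (hh n))

theorem BorelLF.exists_tuple_selector (hG : BorelLF G) {P : X → (Fin k → X) → Prop}
    (hP : Measurable fun q : X × (Fin k → X) => P q.1 q.2)
    (hr : ∀ x v, P x v → ∀ i, G.Reachable x (v i)) :
    ∃ φ : X → Fin k → X, Measurable φ ∧ ∀ x, (∃ v, P x v) → P x (φ x) := by
  obtain ⟨h, hh, hcov⟩ := hG.exists_tuple_moves k
  obtain ⟨m, hm, hm'⟩ := exists_measurable_least (P := fun x n => P x (h n x)) fun n =>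
    Measurable.comp (g := fun q : X × (Fin k → X) => P q.1 q.2) hP (measurable_id.prodMk (hh n))
  refine ⟨fun x => h (m x) x, ?_, fun x ⟨v, hv⟩ => ?_⟩
  · have : Measurable fun p : ℕ × X => h p.1 p.2 := measurable_from_prod_countable_right hh
    exact this.comp (hm.prodMk measurable_id)
  · obtain ⟨n, rfl⟩ := hcov _ _ (hr x v hv)
    exact (hm' x ⟨n, hv⟩).1

/-- `x` has at least four neighbours. -/
def HighBr (H : SimpleGraph X) (x : X) : Prop :=
  ∃ v : Fin 4 → X, (∀ i, H.Adj x (v i)) ∧ Function.Injective v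

/-- `x` has exactly three neighbours. -/
def LowBr (H : SimpleGraph X) (x : X) : Prop := Br H x ∧ ¬ HighBr H x

theorem measurable_injective : Measurable fun v : Fin k → X => Function.Injective v := by
  refine Measurable.forall fun i => Measurable.forall fun j => ?_
  exact (measurable_eq (measurable_pi_apply i) (measurable_pi_apply j)).imp measurable_const

theorem BorelLF.measurable_highBr (hG : BorelLF G) (hH : BorelGraph H) (hle : H ≤ G) :
    Measurable (HighBr H) := by
  refine hG.measurable_exists_tuple
    (P := fun x v => (∀ i, H.Adj x (v i)) ∧ Function.Injective v) ?_
    fun x v h i => (hle (h.1 i)).reachable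
  exact (Measurable.forall fun i => hH.adj measurable_fst (by fun_prop)).and
    (measurable_injective.comp measurable_snd)

theorem BorelLF.measurable_lowBr (hG : BorelLF G) (hH : BorelGraph H) (hle : H ≤ G) :
    Measurable (LowBr H) :=
  (hG.measurable_br hH hle).and (hG.measurable_highBr hH hle).not

/-- `s` lists four neighbours of each branch vertex, or all of them if there are only three. -/
structure IsSlots (H : SimpleGraph X) (s : X → Fin 4 → X) : Prop where
  adj : ∀ x, Br H x → ∀ i, H.Adj x (s x i)
  inj_or : ∀ x, Br H x → Function.Injective (s x) ∨ ∀ u, H.Adj x u → ∃ i, u = s x i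

theorem BorelLF.exists_slots (hG : BorelLF G) (hH : BorelGraph H) (hle : H ≤ G) :
    ∃ s : X → Fin 4 → X, Measurable s ∧ IsSlots H s := by
  obtain ⟨s, hs, hs'⟩ := hG.exists_tuple_selector (P := fun x (v : Fin 4 → X) =>
    (∀ i, H.Adj x (v i)) ∧ (Function.Injective v ∨ ∀ u, H.Adj x u → ∃ i, u = v i)) (by
      refine (Measurable.forall fun i => hH.adj measurable_fst (by fun_prop)).and
        ((measurable_injective.comp measurable_snd).or ?_)
      refine hG.measurable_forall measurable_fst
        (P := fun (q : X × (Fin 4 → X)) u => H.Adj q.1 u → ∃ i, u = q.2 i)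
        ((hH.adj (by fun_prop) (by fun_prop)).imp
          (Measurable.exists fun i => measurable_eq (by fun_prop) (by fun_prop))) fun a y h => ?_
      push Not at h
      exact (hle h.1).reachable) fun x v h i => (hle (h.1 i)).reachable
  have hex : ∀ x, Br H x → ∃ v : Fin 4 → X,
      (∀ i, H.Adj x (v i)) ∧ (Function.Injective v ∨ ∀ u, H.Adj x u → ∃ i, u = v i) := by
    rintro x ⟨a, b, c, hab, hac, hbc, ha, hb, hc⟩
    by_cases h : ∃ d, H.Adj x d ∧ d ≠ a ∧ d ≠ b ∧ d ≠ c
    · obtain ⟨d, hd, hda, hdb, hdc⟩ := h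
      refine ⟨![a, b, c, d], fun i => by fin_cases i <;> assumption, Or.inl fun i j => ?_⟩
      fin_cases i <;> fin_cases j <;> simp_all [eq_comm]
    · push Not at h
      refine ⟨![a, b, c, c], fun i => by fin_cases i <;> assumption, Or.inr fun u hu => ?_⟩
      by_cases hua : u = a
      · exact ⟨0, hua⟩
      by_cases hub : u = b
      · exact ⟨1, hub⟩
      · exact ⟨2, h u hu hua hub⟩
  exact ⟨s, hs, fun x hx => (hs' x (hex x hx)).1, fun x hx => (hs' x (hex x hx)).2⟩

omit [MeasurableSpace X] [StandardBorelSpace X] in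
theorem IsSlots.of_lowBr {s : X → Fin 4 → X} (hs : IsSlots H s) {x u : X} (hx : LowBr H x)
    (hu : H.Adj x u) : ∃ i, u = s x i :=
  (hs.inj_or x hx.1).elim (fun h => (hx.2 ⟨s x, hs.adj x hx.1, h⟩).elim) fun h => h u hu

omit [MeasurableSpace X] [StandardBorelSpace X] in
theorem IsSlots.injective {s : X → Fin 4 → X} (hs : IsSlots H s) {x : X} (hx : Br H x)
    (hx' : HighBr H x) : Function.Injective (s x) := by
  obtain ⟨v, hv, hinj⟩ := hx'
  refine (hs.inj_or x hx).elim id fun h => ?_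
  choose σ hσ using fun i => h (v i) (hv i)
  have hσi : Function.Injective σ := fun i j hij => hinj (by rw [hσ, hσ, hij])
  intro i j hij
  obtain ⟨i, rfl⟩ := Finite.surjective_of_injective hσi i
  obtain ⟨j, rfl⟩ := Finite.surjective_of_injective hσi j
  rw [← hσ, ← hσ] at hij
  rw [hinj hij]

omit [MeasurableSpace X] [StandardBorelSpace X] in
theorem Br.of_four {x : X} {v : Fin 4 → X} (hinj : Function.Injective v)
    (hb : ∀ i j, ¬ H.Adj x (v i) → ¬ H.Adj x (v j) → v i = v j) : Br H x := by
  have hne : ∀ i j, i ≠ j → v i ≠ v j := fun i j h h' => h (hinj h')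
  by_cases h : ∃ i, ¬ H.Adj x (v i)
  · obtain ⟨i, hi⟩ := h
    have hnb : ∀ j, j ≠ i → H.Adj x (v j) := fun j hj => by
      by_contra h
      exact hj (hinj (hb _ _ h hi))
    refine ⟨v (i + 1), v (i + 2), v (i + 3), hne _ _ ?_, hne _ _ ?_, hne _ _ ?_, hnb _ ?_, hnb _ ?_,
      hnb _ ?_⟩
    all_goals (clear hi hnb; revert i; decide)
  · push Not at h
    exact ⟨v 0, v 1, v 2, hne _ _ (by decide), hne _ _ (by decide), hne _ _ (by decide), h _, h _, h _⟩

omit [MeasurableSpace X] [StandardBorelSpace X] in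
theorem HighBr.br {x : X} (hx : HighBr H x) : Br H x := by
  obtain ⟨v, hv, hinj⟩ := hx
  exact .of_four hinj fun i _ h => (h (hv i)).elim

end Coloring

/-! ### Removing stars around vertices of degree three -/

section StarCombinatorics

variable {X : Type*} {G H K : SimpleGraph X} {s : X → Fin 4 → X}

/-- `p` is joined to the branch vertex `q` by a contracted edge. -/
def Linked (H : SimpleGraph X) (p q : X) : Prop := ∃ u, First H p u q

theorem Linked.symm {p q : X} (h : Linked H p q) (hp : Br H p) : Linked H q p :=
  h.elim fun _ h => h.symm hp

theorem Linked.reachable {p q : X} (h : Linked H p q) : H.Reachable p q :=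
  h.elim fun _ h => h.reachable

/-- The distinct vertices `a` and `b` of degree three are close to each other. -/
def Conflict (H : SimpleGraph X) (s : X → Fin 4 → X) (a b : X) : Prop :=
  a ≠ b ∧ LowBr H a ∧ LowBr H b ∧
    ((∃ x, Br H x ∧ ∃ i j, First H x (s x i) a ∧ First H x (s x j) b) ∨
      ∃ x, LowBr H x ∧ Linked H a x ∧ ∃ y, LowBr H y ∧ Linked H x y ∧ Linked H y b)

theorem Conflict.symm {a b : X} (h : Conflict H s a b) : Conflict H s b a := by
  obtain ⟨hne, ha, hb, h⟩ := h
  refine ⟨hne.symm, hb, ha, h.imp ?_ ?_⟩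
  · exact fun ⟨x, hx, i, j, hi, hj⟩ => ⟨x, hx, j, i, hj, hi⟩
  · exact fun ⟨x, hx, hax, y, hy, hxy, hyb⟩ =>
      ⟨y, hy, hyb.symm hy.1, x, hx, hxy.symm hx.1, hax.symm ha.1⟩

theorem Conflict.reachable {a b : X} (h : Conflict H s a b) : H.Reachable a b := by
  obtain ⟨-, -, -, ⟨x, -, i, j, hi, hj⟩ | ⟨x, -, hax, y, -, hxy, hyb⟩⟩ := h
  · exact hi.reachable.symm.trans hj.reachable
  · exact hax.reachable.trans (hxy.reachable.trans hyb.reachable)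

theorem Conflict.exists_cover (hs : IsSlots H s) (a : X) :
    ∃ e : (Fin 4 × Fin 4 ⊕ Fin 4 × Fin 4 × Fin 4) → X, ∀ b, Conflict H s a b → ∃ i, e i = b := by
  classical
  let φ : X → Fin 4 → X := fun x i => if h : ∃ y, First H x (s x i) y then h.choose else x
  have hφ : ∀ {x i y}, First H x (s x i) y → φ x i = y := by
    intro x i y h
    have hex : ∃ y, First H x (s x i) y := ⟨y, h⟩
    simp only [φ, hex, dif_pos]
    exact hex.choose_spec.unique h
  have hlink : ∀ {x y}, LowBr H x → Linked H x y → ∃ i, φ x i = y := by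
    rintro x y hx ⟨u, hu⟩
    obtain ⟨i, rfl⟩ := hs.of_lowBr hx hu.adj
    exact ⟨i, hφ hu⟩
  refine ⟨Sum.elim (fun i => φ (φ a i.1) i.2) fun i => φ (φ (φ a i.1) i.2.1) i.2.2, ?_⟩
  rintro b ⟨-, ha, -, ⟨x, hx, i, j, hi, hj⟩ | ⟨x, hx, hax, y, hy, hxy, hyb⟩⟩
  · obtain ⟨k, hk⟩ := hlink ha (Linked.symm ⟨_, hi⟩ hx)
    exact ⟨.inl (k, j), by simp [hk, hφ hj]⟩
  · obtain ⟨k, rfl⟩ := hlink ha hax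
    obtain ⟨l, rfl⟩ := hlink hx hxy
    obtain ⟨m, rfl⟩ := hlink hy hyb
    exact ⟨.inr (k, l, m), rfl⟩

/-- The vertices which meet the star of a vertex of degree three. -/
def deficient (H : SimpleGraph X) : Set X :=
  {x | LowBr H x ∨ ¬ Br H x ∧ ∃ y, Linked H x y ∧ LowBr H y}

variable {A : Set X}

theorem exists_slots_of_br (hs : IsSlots H s) {x : X} (hx : Br H x) :
    ∃ i j k, s x i ≠ s x j ∧ s x i ≠ s x k ∧ s x j ≠ s x k := by
  by_cases hh : HighBr H x
  · have := hs.injective hx hh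
    exact ⟨0, 1, 2, this.ne (by decide), this.ne (by decide), this.ne (by decide)⟩
  · obtain ⟨a, b, c, hab, hac, hbc, ha, hb, hc⟩ := hx
    obtain ⟨i, rfl⟩ := hs.of_lowBr ⟨⟨a, b, c, hab, hac, hbc, ha, hb, hc⟩, hh⟩ ha
    obtain ⟨j, rfl⟩ := hs.of_lowBr ⟨⟨_, b, c, hab, hac, hbc, ha, hb, hc⟩, hh⟩ hb
    obtain ⟨k, rfl⟩ := hs.of_lowBr ⟨⟨_, _, c, hab, hac, hbc, ha, hb, hc⟩, hh⟩ hc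
    exact ⟨i, j, k, hab, hac, hbc⟩

/-- Removing the stars around a set of pairwise non-conflicting vertices of degree three. -/
theorem prune_star (hac : H.IsAcyclic) (hH : Ample H) (hs : IsSlots H s)
    (hA : ∀ a ∈ A, LowBr H a) (hconf : ∀ a ∈ A, ∀ b ∈ A, ¬ Conflict H s a b) {K : SimpleGraph X}
    (hK : K = prune H fun y _ => y ∈ A) :
    Ample K ∧ (∀ x, HighBr H x → Br K x) ∧ (∀ x ∈ supp H, ∃ y ∈ supp K, H.Reachable x y) ∧
      (∀ a ∈ A, a ∉ supp K) ∧ ∀ x a, ¬ Br H x → Linked H x a → a ∈ A → x ∉ supp K := by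
  have hle : K ≤ H := hK ▸ prune_le
  have hsat : Saturated H K := hK ▸ prune_saturated
  have hadj : ∀ {x u y : X}, Br H x → First H x u y → (K.Adj x u ↔ x ∉ A ∧ y ∉ A) := fun hx h => by
    rw [hK]; exact prune_adj hx h
  have hbad : ∀ {x i j}, Br H x → ∀ {a b}, First H x (s x i) a → First H x (s x j) b → a ∈ A →
      b ∈ A → s x i = s x j := by
    intro x i j hx a b hi hj ha hb
    by_cases hab : a = b
    · subst hab
      exact hi.inj hac hj
    · exact (hconf a ha b hb ⟨hab, hA a ha, hA b hb, .inl ⟨x, hx, i, j, hi, hj⟩⟩).elim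
  have hlost : ∀ {x u}, Br H x → x ∉ A → H.Adj x u → ¬ K.Adj x u → ∃ a ∈ A, First H x u a := by
    intro x u hx hxA hxu hnu
    obtain ⟨a, ha⟩ := hH.exists_first x u hxu
    by_contra hno
    exact hnu ((hadj hx ha).2 ⟨hxA, fun h => hno ⟨a, h, ha⟩⟩)
  have hone : ∀ {x}, Br H x → x ∉ A → ∀ i j, ¬ K.Adj x (s x i) → ¬ K.Adj x (s x j) →
      s x i = s x j := by
    intro x hx hxA i j hi hj
    obtain ⟨a, ha, hia⟩ := hlost hx hxA (hs.adj x hx i) hi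
    obtain ⟨b, hb, hjb⟩ := hlost hx hxA (hs.adj x hx j) hj
    exact hbad hx hia hjb ha hb
  have hin : ∀ a ∈ A, a ∉ supp K := by
    rintro a ha ⟨u, hu⟩
    obtain ⟨y, hy⟩ := hH.exists_first a u (hle hu)
    exact ((hadj (hA a ha).1 hy).1 hu).1 ha
  have htwo : ∀ {x}, Br H x → x ∉ A → ∀ w, ∃ v, v ≠ w ∧ K.Adj x v := by
    intro x hx hxA w
    obtain ⟨i, j, k, hij, hik, hjk⟩ := exists_slots_of_br hs hx
    by_contra! hno
    have hne : ∀ i j, s x i ≠ s x j → s x i = w ∨ s x j = w := fun i j hij => by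
      by_contra! h
      exact hij (hone hx hxA i j (hno _ h.1) (hno _ h.2))
    have h1 := hne i j hij
    have h2 := hne i k hik
    have h3 := hne j k hjk
    grind
  have hhigh : ∀ x, HighBr H x → Br K x := fun x hx =>
    .of_four (hs.injective hx.br hx) (hone hx.br fun h => (hA x h).2 hx)
  have hsupp : ∀ {x}, Br H x → x ∉ A → x ∈ supp K := fun {x} hx hxA =>
    (htwo hx hxA x).imp fun _ h => h.2
  refine ⟨hH.of_saturated hle hsat (fun x hx hb => htwo hb fun h => hin x h hx) ?_, hhigh, ?_, hin,
    ?_⟩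
  · intro x v y hx hxK hxv hxy
    obtain ⟨hxA, hyA⟩ := (hadj hx hxy).1 hxv
    have hex : ∀ {x}, Br H x → x ∉ A → ¬ Br K x → LowBr H x ∧ ∃ u, ∃ a ∈ A, First H x u a := by
      intro x hx hxA hxK
      refine ⟨⟨hx, fun h => hxK (hhigh x h)⟩, ?_⟩
      obtain ⟨a, b, c, hab, hac, hbc, ha, hb, hc⟩ := hx
      by_contra! hno
      have hk : ∀ u, H.Adj x u → K.Adj x u := fun u hu => by
        by_contra h
        obtain ⟨a, ha, hua⟩ := hlost ⟨_, _, _, hab, hac, hbc, ‹_›, ‹_›, ‹_›⟩ hxA hu h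
        exact hno u a ha hua
      exact hxK ⟨a, b, c, hab, hac, hbc, hk _ ha, hk _ hb, hk _ hc⟩
    by_contra hyK
    obtain ⟨hxl, u, a, ha, hua⟩ := hex hx hxA hxK
    obtain ⟨hyl, w, b, hb, hwb⟩ := hex hxy.br hyA hyK
    by_cases hab : a = b
    · subst hab
      have hne := hxy.ne hac
      have hvu : v = u := eq_of_avoid hac hxy.adj hua.adj <| (hxy.avoid_left hac).trans <|
        (hwb.avoid_br hx hne (fun h => hxA (h ▸ ha))).trans (hua.avoid_left hac).symm
      exact ((hadj hx hua).1 (hvu ▸ hxv)).2 ha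
    · exact hconf a ha b hb ⟨hab, hA a ha, hA b hb, .inr ⟨x, hxl, Linked.symm ⟨u, hua⟩ hx, y, hyl,
        ⟨v, hxy⟩, w, hwb⟩⟩
  · rintro x ⟨u, hu⟩
    obtain ⟨y, hy⟩ := hH.exists_first x u hu
    by_cases hyA : y ∈ A
    · obtain ⟨i, j, k, hij, -, -⟩ := exists_slots_of_br hs hy.br
      obtain ⟨a, ha⟩ := hH.exists_first y _ (hs.adj y hy.br i)
      obtain ⟨b, hb⟩ := hH.exists_first y _ (hs.adj y hy.br j)
      by_cases haA : a ∈ A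
      · have hbA : b ∉ A := fun hbA => hij (hbad hy.br ha hb haA hbA)
        exact ⟨b, hsupp hb.br hbA, hy.reachable.trans hb.reachable⟩
      · exact ⟨a, hsupp ha.br haA, hy.reachable.trans ha.reachable⟩
    · exact ⟨y, hsupp hy.br hyA, hy.reachable⟩
  · rintro x a hx ⟨u, hu⟩ ha ⟨v, hv⟩
    have hxu : K.Adj x u := by
      by_cases hvu : v = u
      · exact hvu ▸ hv
      · exact hsat v x u hx hu.adj hvu hv.symm
    obtain ⟨w, hw, -⟩ := hu.saturated hle hsat hxu
    exact hin a ha ⟨w, hw⟩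

end StarCombinatorics

section StarMeasure

variable {X : Type*} [MeasurableSpace X] [StandardBorelSpace X] {G H : SimpleGraph X}

theorem BorelLF.measurable_linked (hG : BorelLF G) (hH : BorelGraph H) (hle : H ≤ G) :
    Measurable fun p : X × X => Linked H p.1 p.2 := by
  refine hG.measurable_exists measurable_fst (P := fun (p : X × X) u => First H p.1 u p.2) ?_
    fun p u h => (hle h.adj).reachable
  have : Measurable fun q : (X × X) × X => (q.1.1, q.2, q.1.2) := by fun_prop
  exact (hG.measurable_first hH hle).comp this

theorem BorelLF.measurableSet_deficient (hG : BorelLF G) (hH : BorelGraph H) (hle : H ≤ G) :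
    MeasurableSet (deficient H) := by
  refine measurableSet_setOfPred.2 ((hG.measurable_lowBr hH hle).or
    ((hG.measurable_br hH hle).not.and (hG.measurable_exists measurable_id
      (P := fun x y => Linked H x y ∧ LowBr H y) ?_ fun x y h => h.1.reachable.mono hle)))
  exact (hG.measurable_linked hH hle).and ((hG.measurable_lowBr hH hle).comp measurable_snd)

theorem BorelLF.measurable_conflict (hG : BorelLF G) (hH : BorelGraph H) (hle : H ≤ G)
    {s : X → Fin 4 → X} (hs : Measurable s) : Measurable fun p : X × X => Conflict H s p.1 p.2 := by
  have hlow := hG.measurable_lowBr hH hle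
  have hlink := hG.measurable_linked hH hle
  have hf := hG.measurable_first hH hle
  have hsi : ∀ i, Measurable fun x => s x i := fun i => (measurable_pi_apply i).comp hs
  refine (measurable_eq measurable_fst measurable_snd).not.and <| (hlow.comp measurable_fst).and <|
    (hlow.comp measurable_snd).and <| Measurable.or ?_ ?_
  · refine hG.measurable_exists measurable_fst (P := fun (p : X × X) x =>
      Br H x ∧ ∃ i j, First H x (s x i) p.1 ∧ First H x (s x j) p.2) ?_
        fun p x ⟨_, i, j, hi, _⟩ => (hi.reachable.mono hle).symm
    refine ((hG.measurable_br hH hle).comp measurable_snd).and <| Measurable.exists fun i =>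
      Measurable.exists fun j => ?_
    have h1 : Measurable fun q : (X × X) × X => (q.2, s q.2 i, q.1.1) :=
      measurable_snd.prodMk (((hsi i).comp measurable_snd).prodMk (by fun_prop))
    have h2 : Measurable fun q : (X × X) × X => (q.2, s q.2 j, q.1.2) :=
      measurable_snd.prodMk (((hsi j).comp measurable_snd).prodMk (by fun_prop))
    exact (hf.comp h1).and (hf.comp h2)
  · refine hG.measurable_exists measurable_fst (P := fun (p : X × X) x =>
      LowBr H x ∧ Linked H p.1 x ∧ ∃ y, LowBr H y ∧ Linked H x y ∧ Linked H y p.2) ?_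
        fun p x h => h.2.1.reachable.mono hle
    refine (hlow.comp measurable_snd).and <|
      (measurable_rel hlink (by fun_prop) (by fun_prop)).and ?_
    refine hG.measurable_exists measurable_snd (P := fun (q : (X × X) × X) y =>
      LowBr H y ∧ Linked H q.2 y ∧ Linked H y q.1.2) ?_ fun p x h => h.2.1.reachable.mono hle
    exact (hlow.comp measurable_snd).and <| (measurable_rel hlink (by fun_prop) (by fun_prop)).and
      (measurable_rel hlink (by fun_prop) (by fun_prop))

theorem BorelLF.exists_star_step (hG : BorelLF G) (hac : G.IsAcyclic) (hH : BorelGraph H)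
    (hle : H ≤ G) (hA : Ample H) (ν : Measure X) :
    ∃ K, BorelGraph K ∧ K ≤ H ∧ Saturated H K ∧ Ample K ∧ (∀ x, HighBr H x → Br K x) ∧
      (∀ x ∈ supp H, ∃ y ∈ supp K, H.Reachable x y) ∧
      ν (deficient H) ≤ 81 * ν (supp H \ supp K) := by
  obtain ⟨s, hs, hslots⟩ := hG.exists_slots hH hle
  obtain ⟨c, hc, hc81, hcol⟩ := hG.exists_bounded_coloring (hG.measurable_conflict hH hle hs)
    (fun _ _ h => h.reachable.mono hle) (fun _ h => h.1 rfl) (fun _ _ h => h.symm)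
    (Conflict.exists_cover hslots)
  let A : ℕ → Set X := fun k => {a | LowBr H a ∧ c a = k}
  have hAm : ∀ k, MeasurableSet (A k) := fun k => measurableSet_setOfPred.2 <|
    (hG.measurable_lowBr hH hle).and (measurableSet_setOfPred.1 (hc (measurableSet_singleton k)))
  let K : ℕ → SimpleGraph X := fun k => prune H fun y _ => y ∈ A k
  have hK : ∀ k, _ := fun k => prune_star (hac.anti hle) hA hslots (A := A k) (fun a ha => ha.1)
    (fun a ha b hb h => hcol a b h (ha.2.trans hb.2.symm)) (K := K k) rfl
  obtain ⟨k, -, hk⟩ := Finset.exists_max_image (Finset.range 81)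
    (fun k => ν (supp H \ supp (K k))) ⟨0, by simp⟩
  refine ⟨K k, hG.borel_prune hH hle (Q := fun y _ => y ∈ A k) (measurable_mem (hAm k) measurable_fst),
    prune_le, prune_saturated, (hK k).1, (hK k).2.1, (hK k).2.2.1, ?_⟩
  have hcover : deficient H ⊆ ⋃ k ∈ Finset.range 81, supp H \ supp (K k) := by
    have hc' : ∀ a, c a ∈ Finset.range 81 := fun a => Finset.mem_range.2 <|
      Nat.lt_succ_of_le ((hc81 a).trans (by simp))
    rintro x (hx | ⟨hx, y, hxy, hy⟩)
    · obtain ⟨_, _, _, -, -, -, h, -⟩ := hx.1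
      exact Set.mem_biUnion (hc' x) ⟨⟨_, h⟩, (hK _).2.2.2.1 x ⟨hx, rfl⟩⟩
    · exact Set.mem_biUnion (hc' y) ⟨⟨_, hxy.choose_spec.adj⟩,
        (hK _).2.2.2.2 x y hx hxy ⟨hy, rfl⟩⟩
  calc ν (deficient H) ≤ ∑ k ∈ Finset.range 81, ν (supp H \ supp (K k)) :=
        (measure_mono hcover).trans (measure_biUnion_finset_le _ _)
    _ ≤ 81 * ν (supp H \ supp (K k)) := by
        refine (Finset.sum_le_card_nsmul _ _ _ hk).trans ?_
        simp

end StarMeasure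

/-! ### Removing a disjoint family of contracted edges -/

section PairStep

variable {X : Type*} {G H K : SimpleGraph X}

theorem Br.mono (hle : K ≤ H) {x : X} : Br K x → Br H x :=
  fun ⟨a, b, c, h1, h2, h3, ha, hb, hc⟩ => ⟨a, b, c, h1, h2, h3, hle ha, hle hb, hle hc⟩

theorem HighBr.mono (hle : K ≤ H) {x : X} : HighBr K x → HighBr H x :=
  fun ⟨v, hv, hinj⟩ => ⟨v, fun i => hle (hv i), hinj⟩

theorem Saturated.trans {L : SimpleGraph X} (hKH : K ≤ H) (hLK : L ≤ K) (h₁ : Saturated H K)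
    (h₂ : Saturated K L) : Saturated H L := fun u v w hv hvw hne huv =>
  h₂ u v w (fun h => hv (h.mono hKH)) (h₁ u v w hv hvw hne (hLK huv)) hne huv

theorem prune_pairs (hac : H.IsAcyclic) (hH : Ample H) {S : Set X} {g : X → X}
    (hinj : ∀ x ∈ S, ∀ y ∈ S, g x = g y → x = y) (hdisj : ∀ x ∈ S, ∀ y ∈ S, g x = y → x = y)
    {K : SimpleGraph X} (hK : K = prune H fun y z => y ∈ S ∧ z = g y ∧ HighBr H y ∧ HighBr H z) :
    Ample K ∧ (∀ x, Br H x → Br K x) ∧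
      ∀ x ∈ S, ∀ u, First K x u (g x) → HighBr K x → HighBr K (g x) → False := by
  have hle : K ≤ H := hK ▸ prune_le
  have hsat : Saturated H K := hK ▸ prune_saturated
  let Q : X → X → Prop := fun y z => y ∈ S ∧ z = g y ∧ HighBr H y ∧ HighBr H z
  have hadj : ∀ {x u y : X}, Br H x → First H x u y → (K.Adj x u ↔ ¬ Q x y ∧ ¬ Q y x) :=
    fun hx h => by rw [hK]; exact prune_adj hx h
  have hlost : ∀ {x u}, Br H x → H.Adj x u → ¬ K.Adj x u → ∃ y, First H x u y ∧ (Q x y ∨ Q y x) := by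
    intro x u hx hxu hnu
    obtain ⟨y, hy⟩ := hH.exists_first x u hxu
    rw [hadj hx hy] at hnu
    exact ⟨y, hy, by tauto⟩
  have hone : ∀ {x u v}, Br H x → H.Adj x u → H.Adj x v → ¬ K.Adj x u → ¬ K.Adj x v → u = v := by
    intro x u v hx hxu hxv hu hv
    obtain ⟨y, hy, hQy⟩ := hlost hx hxu hu
    obtain ⟨z, hz, hQz⟩ := hlost hx hxv hv
    have hyz : y = z := by
      rcases hQy with ⟨hx1, rfl, -⟩ | ⟨hy1, hy2, -⟩ <;> rcases hQz with ⟨hx1, rfl, -⟩ | ⟨hz1, hz2, -⟩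
      · rfl
      · exact (hz.ne hac (hdisj z hz1 x hx1 hz2.symm).symm).elim
      · exact (hy.ne hac (hdisj y hy1 x hx1 hy2.symm).symm).elim
      · exact hinj y hy1 z hz1 (hy2.symm.trans hz2)
    subst hyz
    exact hy.inj hac hz
  have hbr : ∀ x, Br H x → Br K x := by
    intro x hx
    by_cases hh : HighBr H x
    · obtain ⟨v, hv, hvi⟩ := hh
      exact .of_four hvi fun i j => hone hx (hv i) (hv j)
    · have hk : ∀ u, H.Adj x u → K.Adj x u := fun u hu => by
        by_contra h
        obtain ⟨y, -, ⟨-, -, h, -⟩ | ⟨-, -, -, h⟩⟩ := hlost hx hu h <;> exact hh h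
      obtain ⟨a, b, c, hab, hac, hbc, ha, hb, hc⟩ := hx
      exact ⟨a, b, c, hab, hac, hbc, hk _ ha, hk _ hb, hk _ hc⟩
  refine ⟨hH.of_saturated hle hsat ?_ fun x v y _ _ _ h => hbr y h.br, hbr, ?_⟩
  · intro x _ hx w
    obtain ⟨a, b, -, hab, -, -, ha, hb, -⟩ := hbr x hx
    by_cases haw : a = w
    · exact ⟨b, fun h => hab (haw.trans h.symm), hb⟩
    · exact ⟨a, haw, ha⟩
  · intro x hx u hu h1 h2
    exact ((hadj (h1.mono hle).br (hu.of_le hle hbr)).1 hu.adj).1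
      ⟨hx, rfl, h1.mono hle, h2.mono hle⟩

end PairStep

section Limit

variable {X : Type*} [MeasurableSpace X] {G : SimpleGraph X}

/-- Let `M` be a decreasing sequence of ample graphs in which vertices of degree at least four remain
branch vertices, while the contracted edges between two of them are eventually removed. Then a
vertex which is never removed has in its component a vertex which is deficient infinitely often. -/
theorem false_of_survives (hfin : ∀ x, (G.neighborSet x).Finite) (P : Probes G)
    {M : ℕ → SimpleGraph X} (hle : ∀ n, M n ≤ G) (hanti : ∀ n, M (n + 1) ≤ M n)
    (hsat : ∀ n, Saturated (M n) (M (n + 1))) (hM : ∀ n, Ample (M n))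
    (hhigh : ∀ n x, HighBr (M n) x → Br (M (n + 1)) x)
    (hpair : ∀ n, ∀ x ∈ P.sel n, ∀ u, First (M n) x u (P.run n (P.len n) x) → HighBr (M n) x →
      HighBr (M n) (P.run n (P.len n) x) → False)
    {x : X} (hx : ∀ n, x ∈ supp (M n))
    (hdef : ∀ y, G.Reachable x y → ∃ N, ∀ n, N ≤ n → y ∉ deficient (M n)) : False := by
  have hant : Antitone M := antitone_nat_of_succ_le hanti
  have hpairs : ∀ z z' n, (∀ m, n ≤ m → HighBr (M m) z ∧ HighBr (M m) z' ∧
      ∃ w, First (M m) z w z') → False := by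
    intro z z' n h
    obtain ⟨w, k, hk⟩ := (h n le_rfl).2.2
    obtain ⟨v, hv0, -, hvk, hadj, -⟩ := hk.exists_chain
    obtain ⟨m, hm, hlen, hsel, hrun⟩ := P.hits (k + 1) v (fun i hi => hle n (hadj i hi)) n
    have hrun' : P.run m (P.len m) z = z' := by rw [hlen, ← hv0, hrun _ le_rfl, hvk]
    obtain ⟨h1, h2, w', hw'⟩ := h m hm
    exact hpair m z (hv0 ▸ hsel) w' (hrun' ▸ hw') h1 (hrun' ▸ h2)
  have hdich : ∀ y, G.Reachable x y → (∃ n, ∀ m, n ≤ m → HighBr (M m) y) ∨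
      ∃ n, ∀ m, n ≤ m → ¬ Br (M m) y := by
    intro y hy
    obtain ⟨N, hN⟩ := hdef y hy
    by_cases h : ∃ n, N ≤ n ∧ Br (M n) y
    · obtain ⟨n, hn, hb⟩ := h
      have hup : ∀ m, N ≤ m → Br (M m) y → HighBr (M m) y := fun m hm hb => by
        by_contra hh
        exact hN m hm (.inl ⟨hb, hh⟩)
      refine .inl ⟨n, fun m hm => hup m (hn.trans hm) ?_⟩
      induction m, hm using Nat.le_induction with
      | base => exact hb
      | succ m hm ih => exact hhigh m y (hup m (hn.trans hm) ih)
    · exact .inr ⟨N, fun m hm hb => h ⟨m, hm, hb⟩⟩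
  have hfollow : ∀ y u, G.Reachable x y → (∃ n, ∀ m, n ≤ m → ¬ Br (M m) y) →
      (∀ n, (M n).Adj y u) → ∃ n z, ∀ m, n ≤ m → First (M m) y u z ∧ HighBr (M m) z := by
    rintro y u hy ⟨n₁, hn₁⟩ hu
    obtain ⟨n₂, hn₂⟩ := hdef y hy
    have hup : ∀ m, max n₁ n₂ ≤ m → ∀ z, First (M m) y u z → HighBr (M m) z := fun m hm z hz => by
      by_contra hh
      exact hn₂ m ((le_max_right _ _).trans hm)
        (.inr ⟨hn₁ m ((le_max_left _ _).trans hm), z, ⟨u, hz⟩, hz.br, hh⟩)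
    obtain ⟨z, hz⟩ := (hM (max n₁ n₂)).exists_first y u (hu _)
    refine ⟨max n₁ n₂, z, fun m hm => ?_⟩
    suffices h : First (M m) y u z from ⟨h, hup m hm z h⟩
    induction m, hm using Nat.le_induction with
    | base => exact hz
    | succ m hm ih =>
      obtain ⟨-, -, -, h, -⟩ := ih.saturated (hanti m) (hsat m) (hu _)
      exact h (hhigh m z (hup m hm z ih))
  have hnot : ∀ y u, G.Reachable x y → (∃ n, ∀ m, n ≤ m → ¬ Br (M m) y) →
      (∀ n, (M n).Adj y u) → False := by
    intro y u hy hbr hu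
    obtain ⟨u', -, hu'⟩ := exists_forall_of_antitone (F := G.neighborSet y)
      (P := fun n u' => u' ≠ u ∧ (M n).Adj y u') (hfin y) (fun n u' h => ⟨h.1, hanti n h.2⟩)
      fun n => by
        obtain ⟨u', hne, h⟩ := (hM n).leafless u y (hu n).symm
        exact ⟨u', hle n h, hne, h⟩
    obtain ⟨n, z, hz⟩ := hfollow y u hy hbr hu
    obtain ⟨n', z', hz'⟩ := hfollow y u' hy hbr fun n => (hu' n).2
    obtain ⟨n₀, hn₀⟩ := hbr
    refine hpairs z z' (max n₀ (max n n')) fun m hm => ?_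
    simp only [max_le_iff] at hm
    obtain ⟨h1, h2⟩ := hz m hm.2.1
    obtain ⟨h1', h2'⟩ := hz' m hm.2.2
    obtain ⟨w, -, hw, -⟩ := h1.saturated le_rfl (fun _ _ _ _ h _ _ => h) h1.adj
    exact ⟨h2, h2', w, hw z' (.step h1.adj.symm (hn₀ m hm.1) (hu' 0).1 h1')⟩
  obtain ⟨u, -, hu⟩ := exists_forall_of_antitone (F := G.neighborSet x)
    (P := fun n u => (M n).Adj x u) (hfin x) (fun n u h => hanti n h)
    fun n => (hx n).imp fun u h => ⟨hle n h, h⟩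
  have hxu : G.Reachable x u := (hle 0 (hu 0)).reachable
  rcases hdich x .rfl with ⟨n, hn⟩ | h
  · rcases hdich u hxu with ⟨n', hn'⟩ | h
    · refine hpairs x u (max n n') fun m hm => ?_
      rw [max_le_iff] at hm
      exact ⟨hn m hm.1, hn' m hm.2, u, .of_br (hu m) (hn' m hm.2).br⟩
    · exact hnot u x hxu h fun n => (hu n).symm
  · exact hnot x u .rfl h hu

end Limit

section Iteration

variable {X : Type*} [MeasurableSpace X] [StandardBorelSpace X] {G H : SimpleGraph X}

theorem BorelLF.exists_pair_step (hG : BorelLF G) (hac : G.IsAcyclic) (P : Probes G) (n : ℕ)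
    (hH : BorelGraph H) (hle : H ≤ G) (hA : Ample H) :
    ∃ K, BorelGraph K ∧ K ≤ H ∧ Saturated H K ∧ Ample K ∧ (∀ x, Br H x → Br K x) ∧
      ∀ x ∈ P.sel n, ∀ u, First K x u (P.run n (P.len n) x) → HighBr K x →
        HighBr K (P.run n (P.len n) x) → False := by
  obtain ⟨h1, h2, h3⟩ := prune_pairs (hac.anti hle) hA (S := P.sel n) (g := P.run n (P.len n))
    (fun x hx y hy h => P.disj n x hx y hy _ le_rfl _ le_rfl h)
    (fun x hx y hy h => P.disj n x hx y hy _ le_rfl 0 (Nat.zero_le _) (by rw [h, P.run_zero])) rfl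
  have hhigh := hG.measurable_highBr hH hle
  refine ⟨_, hG.borel_prune hH hle ?_, prune_le, prune_saturated, h1, h2, h3⟩
  exact (measurable_mem (P.measurableSet_sel n) measurable_fst).and <|
    (measurable_eq measurable_snd ((P.measurable_run _ _).comp measurable_fst)).and <|
    (hhigh.comp measurable_fst).and (hhigh.comp measurable_snd)

omit [MeasurableSpace X] [StandardBorelSpace X] in
theorem Ample.exists_reachable_supp {K : SimpleGraph X} (hA : Ample H)
    (hbr : ∀ x, Br H x → Br K x) {x : X} (hx : x ∈ supp H) : ∃ y ∈ supp K, H.Reachable x y := by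
  obtain ⟨u, hu⟩ := hx
  obtain ⟨y, hy⟩ := hA.exists_first x u hu
  obtain ⟨a, _, _, -, -, -, h, -⟩ := hbr y hy.br
  exact ⟨y, ⟨a, h⟩, hy.reachable⟩

theorem BorelLF.exists_saturating_measure (hG : BorelLF G) (μ : Measure X) [IsFiniteMeasure μ] :
    ∃ ν : Measure X, IsFiniteMeasure ν ∧
      ∀ s, MeasurableSet s → ν s = 0 → ∀ᵐ x ∂μ, ∀ y, G.Reachable x y → y ∉ s := by
  obtain ⟨h, hh, hcov⟩ := hG.exists_moves
  refine ⟨Measure.sum fun n => ((2 : ENNReal)⁻¹ ^ (n + 1)) • μ.map (h n), ⟨?_⟩, fun s hs h0 => ?_⟩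
  · rw [Measure.sum_apply _ .univ]
    simp only [Measure.smul_apply, smul_eq_mul, Measure.map_apply (hh _) .univ, Set.preimage_univ]
    rw [ENNReal.tsum_mul_right, ENNReal.tsum_geometric_add_one]
    refine ENNReal.mul_lt_top (ENNReal.mul_lt_top (by simp) ?_) (measure_lt_top μ _)
    simp [ENNReal.one_sub_inv_two]
  · have hn : ∀ᵐ x ∂μ, ∀ n, h n x ∉ s := by
      rw [ae_all_iff]
      intro n
      rw [Measure.sum_apply _ hs, ENNReal.tsum_eq_zero] at h0
      have := h0 n
      simp only [Measure.smul_apply, smul_eq_mul, mul_eq_zero] at this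
      rcases this with h1 | h1
      · simp at h1
      · rw [Measure.map_apply (hh n) hs] at h1
        exact measure_eq_zero_iff_ae_notMem.1 h1
    filter_upwards [hn] with x hx y hxy
    obtain ⟨n, rfl⟩ := hcov x y hxy
    exact hx n

/-- An ample Borel graph contains a decreasing sequence of subgraphs, each of them meeting the
components of the previous one, whose intersection is almost everywhere empty. -/
theorem BorelLF.exists_vanishing_chain (hG : BorelLF G) (hac : G.IsAcyclic) (hH : BorelGraph H)
    (hle : H ≤ G) (hA : Ample H) (μ : Measure X) [IsFiniteMeasure μ] :
    ∃ M : ℕ → SimpleGraph X, (∀ n, BorelGraph (M n)) ∧ M 0 ≤ H ∧ (∀ n, M (n + 1) ≤ M n) ∧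
      (∀ x ∈ supp H, ∃ y ∈ supp (M 0), H.Reachable x y) ∧
      (∀ n, ∀ x ∈ supp (M n), ∃ y ∈ supp (M (n + 1)), (M n).Reachable x y) ∧
      ∀ᵐ x ∂μ, ∃ n, x ∉ supp (M n) := by
  obtain ⟨P⟩ := hG.exists_probes
  obtain ⟨ν, hνfin, hν⟩ := hG.exists_saturating_measure μ
  let Good : SimpleGraph X → Prop := fun H => BorelGraph H ∧ H ≤ G ∧ Ample H
  obtain ⟨M₀, hM₀, hM₀H, -, hM₀A, hM₀br, hM₀P⟩ := hG.exists_pair_step hac P 0 hH hle hA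
  have hstep : ∀ (n : ℕ) (H : {H // Good H}), ∃ K : {H // Good H}, K.1 ≤ H.1 ∧ Saturated H.1 K.1 ∧
      (∀ x, HighBr H.1 x → Br K.1 x) ∧ (∀ x ∈ supp H.1, ∃ y ∈ supp K.1, H.1.Reachable x y) ∧
      ν (deficient H.1) ≤ 81 * ν (supp H.1 \ supp K.1) ∧
      ∀ x ∈ P.sel (n + 1), ∀ u, First K.1 x u (P.run (n + 1) (P.len (n + 1)) x) → HighBr K.1 x →
        HighBr K.1 (P.run (n + 1) (P.len (n + 1)) x) → False := by
    rintro n ⟨H, hH, hle, hA⟩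
    obtain ⟨K, hK, hKH, hKs, hKA, hKb, hKr, hKν⟩ := hG.exists_star_step hac hH hle hA ν
    obtain ⟨L, hL, hLK, hLs, hLA, hLb, hLP⟩ :=
      hG.exists_pair_step hac P (n + 1) hK (hKH.trans hle) hKA
    refine ⟨⟨L, hL, hLK.trans (hKH.trans hle), hLA⟩, hLK.trans hKH, hKs.trans hKH hLK hLs,
      fun x hx => hLb x (hKb x hx), fun x hx => ?_, hKν.trans ?_, hLP⟩
    · obtain ⟨y, hy, hxy⟩ := hKr x hx
      obtain ⟨z, hz, hyz⟩ := hKA.exists_reachable_supp hLb hy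
      exact ⟨z, hz, hxy.trans (hyz.mono hKH)⟩
    · gcongr
      exact fun x ⟨y, hy⟩ => ⟨y, hLK hy⟩
  choose next hnext using hstep
  let F : ℕ → {H // Good H} := fun n =>
    Nat.rec ⟨M₀, hM₀, hM₀H.trans hle, hM₀A⟩ (fun n H => next n H) n
  have hF : ∀ n, _ := fun n => hnext n (F n)
  have hM := fun n => (F n).2
  refine ⟨fun n => (F n).1, fun n => (hM n).1, hM₀H, fun n => (hF n).1,
    fun x hx => hA.exists_reachable_supp hM₀br hx, fun n => (hF n).2.2.2.1, ?_⟩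
  have hsm : ∀ n, MeasurableSet (supp (F n).1) := fun n =>
    hG.measurableSet_supp (hM n).1 (hM n).2.1
  have hant : Antitone fun n => supp (F n).1 :=
    antitone_nat_of_succ_le fun n x ⟨y, hy⟩ => ⟨y, (hF n).1 hy⟩
  have hdisj : Pairwise (Function.onFun Disjoint fun n => supp (F n).1 \ supp (F (n + 1)).1) := by
    refine (pairwise_disjoint_on _).2 fun m n hmn => ?_
    exact Set.disjoint_left.2 fun x hx hx' => hx.2 (hant (Nat.succ_le_of_lt hmn) hx'.1)
  have hsum : ∑' n, ν (deficient (F n).1) ≠ ⊤ := by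
    refine ne_top_of_le_ne_top ?_ (ENNReal.tsum_le_tsum fun n => (hF n).2.2.2.2.1)
    rw [ENNReal.tsum_mul_left, ← measure_iUnion hdisj fun n => (hsm n).diff (hsm (n + 1))]
    exact ENNReal.mul_ne_top (by simp) (measure_ne_top _ _)
  have hlim := measure_limsup_atTop_eq_zero hsum
  have hae := hν _ (MeasurableSet.measurableSet_limsup fun n =>
    hG.measurableSet_deficient (hM n).1 (hM n).2.1) hlim
  filter_upwards [hae] with x hx
  by_contra! hno
  refine false_of_survives hG.finite P (M := fun n => (F n).1) (fun n => (hM n).2.1)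
    (fun n => (hF n).1) (fun n => (hF n).2.1) (fun n => (hM n).2.2) (fun n => (hF n).2.2.1) ?_ hno ?_
  · rintro (_ | n)
    exacts [hM₀P, (hF n).2.2.2.2.2]
  · intro y hy
    have := hx y hy
    rw [Filter.mem_limsup_iff_frequently_mem, Filter.not_frequently, Filter.eventually_atTop] at this
    exact this

end Iteration

/-! ### Assembling the one-ended function -/

section Assembly

variable {X : Type*} {G H : SimpleGraph X}

/-- The part of `core G` outside of the components of `G` which contain a hair. -/
def shornCore (G : SimpleGraph X) : SimpleGraph X where
  Adj x y := (core G).Adj x y ∧ ∀ a, G.Reachable x a → a ∉ hair (core G)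
  symm := ⟨fun _ _ h => ⟨h.1.symm, fun a ha => h.2 a ((core_le h.1).reachable.trans ha)⟩⟩
  loopless := ⟨fun _ h => h.1.ne rfl⟩

theorem shornCore_le_core : shornCore G ≤ core G := fun _ _ h => h.1

theorem First.shornCore {x u y : X} (h : First (core G) x u y)
    (hx : ∀ a, G.Reachable x a → a ∉ hair (core G)) : First (shornCore G) x u y := by
  obtain ⟨n, h⟩ := h
  have hstep : ∀ {x u}, (∀ a, G.Reachable x a → a ∉ hair (core G)) → (core G).Adj x u →
      ∀ a, G.Reachable u a → a ∉ hair (core G) := fun hx hxu a ha =>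
    hx a ((core_le hxu).reachable.trans ha)
  induction n generalizing x u with
  | zero =>
    obtain ⟨hxu, ⟨a, b, c, hab, hac, hbc, ha, hb, hc⟩, rfl⟩ := h
    have hu := hstep hx hxu
    exact .of_br ⟨hxu, hx⟩ ⟨a, b, c, hab, hac, hbc, ⟨ha, hu⟩, ⟨hb, hu⟩, hc, hu⟩
  | succ n ih =>
    obtain ⟨hxu, hu, w, hw, -, h⟩ := h
    exact .step ⟨hxu, hx⟩ (fun h => hu (h.mono shornCore_le_core)) hw (ih (hstep hx hxu) h)

variable [MeasurableSpace X] [StandardBorelSpace X]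

theorem BorelLF.ample_shornCore (hG : BorelLF G) (hac : G.IsAcyclic)
    (hends : ∀ c : G.ConnectedComponent, (SimpleGraph.end (G.induce c.supp)).ncard ≠ 2) :
    Ample (shornCore G) := by
  have hl := core_leafless hG.finite
  refine ⟨fun x y hxy => ?_, fun x u hxu => ?_⟩
  · obtain ⟨z, hz, hyz⟩ := hl x y hxy.1
    exact ⟨z, hz, hyz, hxy.symm.2⟩
  · by_contra! hno
    have hray : Ray (core G) x u := ⟨hxu.1, fun y hy => hno y (hy.shornCore hxu.2)⟩
    obtain ⟨r, rfl, hr, hnb⟩ := exists_line hl hxu.1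
    refine false_of_core_line hG hac hends hr hnb fun j =>
      not_br_of_ray hl hray (fun w hw => hxu.2 w (hw.mono core_le)) ?_
    induction j using Int.induction_on with
    | zero => exact .rfl
    | succ i ih => exact ih.trans (hr _).reachable
    | pred i ih =>
      have := hr (-i - 1)
      rw [sub_add_cancel] at this
      exact ih.trans this.symm.reachable

theorem BorelLF.exists_flow (hG : BorelLF G) (hac : G.IsAcyclic)
    (hinf : ∀ x, {y | G.Reachable x y}.Infinite)
    (hends : ∀ c : G.ConnectedComponent, (SimpleGraph.end (G.induce c.supp)).ncard ≠ 2)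
    (μ : Measure X) [IsFiniteMeasure μ] : ∃ B, Flow G B ∧ ∀ᵐ x ∂μ, x ∈ B := by
  have hc := hG.borel_core
  have hhair := hG.measurableSet_hair hc core_le
  have hsupp := hG.measurableSet_supp hc core_le
  have hreach := hG.measurable_reachable hG.borel le_rfl
  have hT : Measurable fun x => ∀ a, G.Reachable x a → a ∉ hair (core G) :=
    hG.measurable_forall measurable_id (P := fun x a => G.Reachable x a → a ∉ hair (core G))
      (hreach.imp (measurable_mem hhair measurable_snd).not) fun x a h => by
        push Not at h
        exact h.1
  have hS : BorelGraph (shornCore G) := Measurable.and hc (hT.comp measurable_fst)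
  obtain ⟨M, hM, hM0, hMa, hMr0, hMr, hMae⟩ := hG.exists_vanishing_chain hac hS
    (shornCore_le_core.trans core_le) (hG.ample_shornCore hac hends) μ
  let K : ℕ → SimpleGraph X := fun n => Nat.casesOn n G fun n => Nat.casesOn n (shornCore G) M
  have hKG : ∀ n, K (n + 1) ≤ K n := by
    rintro (_ | _ | n)
    exacts [shornCore_le_core.trans core_le, hM0, hMa n]
  have hchain := Flow.of_chain hG (K := K) (by rintro (_ | _ | n); exacts [hG.borel, hS, hM n])
    (fun n => (antitone_nat_of_succ_le hKG) (Nat.zero_le n)) hKG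
    (S := {x | (∀ a, G.Reachable x a → a ∉ hair (core G)) ∧ ∃ y ∈ supp (core G), G.Reachable x y})
    (fun x _ => (exists_inf hG.finite (hinf x)).imp fun y h => h.adj) (by
      rintro (_ | _ | n) x ⟨hx, y, hy, hxy⟩ h
      · obtain ⟨z, hz⟩ := hy
        exact ⟨y, ⟨z, hz, fun a ha => hx a (hxy.trans ha)⟩, hxy⟩
      · exact hMr0 x h
      · exact hMr n x h)
  refine ⟨_, (Flow.of_no_core hG hinf).union ((Flow.of_hair hG hc core_le
    (core_leafless hG.finite)).union hchain ?_ ?_) ?_ ?_, ?_⟩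
  · exact measurableSet_setOfPred.2 <| hG.measurable_exists measurable_id
      (P := fun x a => a ∈ hair (core G) ∧ G.Reachable x a)
      ((measurable_mem hhair measurable_snd).and hreach) fun x a h => h.2
  · exact fun x y hxy ⟨a, ha, h⟩ => ⟨a, ha, hxy.symm.reachable.trans h⟩
  · refine measurableSet_setOfPred.2 <| hG.measurable_forall measurable_id
      (P := fun x a => G.Reachable x a → a ∉ supp (core G))
      (hreach.imp (measurable_mem hsupp measurable_snd).not) fun x a h => ?_
    push Not at h
    exact h.1
  · exact fun x y hxy h a ha => h a (hxy.reachable.trans ha)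
  · filter_upwards [hMae] with x ⟨n, hn⟩
    by_cases h1 : ∀ y, G.Reachable x y → y ∉ supp (core G)
    · exact .inl h1
    by_cases h2 : ∃ a ∈ hair (core G), G.Reachable x a
    · exact .inr (.inl h2)
    push Not at h1 h2
    obtain ⟨y, hxy, hy⟩ := h1
    exact .inr (.inr ⟨⟨fun a h ha => h2 a ha h, y, hy, hxy⟩, n + 2, hn⟩)

end Assembly

end OneEndedProof

theorem stmt_3 {X : Type*} [MeasurableSpace X] [StandardBorelSpace X]
    (G : SimpleGraph X) (hGmeas : MeasurableSet {p : X × X | G.Adj p.1 p.2})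
    (hlf : ∀ x : X, (G.neighborSet x).Finite)
    (hacyc : G.IsAcyclic)
    (hends : ∀ c : G.ConnectedComponent,
      SimpleGraph.end (G.induce c.supp) ≠ ∅ ∧
        (SimpleGraph.end (G.induce c.supp)).ncard ≠ 2)
    (μ : Measure X) [IsProbabilityMeasure μ] :
    ∃ B : Set X, MeasurableSet B ∧ μ Bᶜ = 0 ∧
      ∃ f : B → X, Measurable f ∧ (∀ x : B, G.Adj (x : X) (f x)) ∧ OneEnded f := by
  have hG : OneEndedProof.BorelLF G := ⟨measurableSet_setOfPred.1 hGmeas, hlf⟩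
  have hinf : ∀ x, {y | G.Reachable x y}.Infinite := by
    intro x
    have := OneEndedProof.infinite_of_end_ne_empty (hends (G.connectedComponentMk x)).1
    refine (Set.infinite_coe_iff.1 this).mono fun y hy => ?_
    exact (SimpleGraph.ConnectedComponent.exact hy).symm
  obtain ⟨B, ⟨f, hf, hadj, hone⟩, hB⟩ := hG.exists_flow hacyc hinf (fun c => (hends c).2) μ
  have hsub : ∀ x, x ∉ toMeasurable μ Bᶜ → x ∈ B := fun x hx => by
    by_contra h
    exact hx (subset_toMeasurable μ Bᶜ h)
  refine ⟨(toMeasurable μ Bᶜ)ᶜ, (measurableSet_toMeasurable μ _).compl, ?_, fun x => f x,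
    hf.comp measurable_subtype_coe, fun x => hadj x (hsub x x.2), ?_⟩
  · rw [compl_compl, measure_toMeasurable]
    exact mem_ae_iff.1 hB
  · rintro ⟨u, hu⟩
    exact hone ⟨fun i => u i, fun i => hsub _ (u i).2, hu⟩
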